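/- Let k ≥ 0 and n̄ = (n_1,…,n_r) with r ≥ 1 and n_i ≥ 1 for all i, and let R := {i ∈ [r] : n_i ≥ 2}. If k ≤ Σ_{i∈R} ⌊(n_i − 2)/2⌋, then every (k,n̄)-PPSN polytope has dimension at least 2k + |R| + 1. -/

import Mathlib

open Set

section PolytopeDefs

variable {E : Type*} [AddCommGroup E] [Module ℝ E]
variable {E' : Type*} [AddCommGroup E'] [Module ℝ E']

/-- A polytope: the convex hull of a finite set of points. -/
def IsPolytope (P : Set E) : Prop :=
  ∃ V : Finset E, P = convexHull ℝ (V : Set E)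

/-- The dimension of a set of points: the dimension of its affine span. -/
noncomputable def polyDim (P : Set E) : ℕ :=
  Module.finrank ℝ (affineSpan ℝ P).direction

/-- A nonempty exposed face of `P`: a nonempty set of the form
`{x ∈ P | ⟨c,x⟩ = max_{y ∈ P} ⟨c,y⟩}` for a linear functional `c`. -/
def IsFace (P F : Set E) : Prop :=
  F.Nonempty ∧ ∃ c : E →ₗ[ℝ] ℝ, F = {x ∈ P | ∀ y ∈ P, c y ≤ c x}

/-- The `k`-skeleton of `P`: its nonempty faces of dimension at most `k`. -/
def skel (k : ℕ) (P : Set E) : Set (Set E) :=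
  {F | IsFace P F ∧ polyDim F ≤ k}

/-- The set of all nonempty faces of `P`. -/
def facesOf (P : Set E) : Set (Set E) :=
  {F | IsFace P F}

/-- Combinatorial equivalence of `k`-skeletons: the posets of faces of dimension
at most `k`, ordered by inclusion, are order-isomorphic. -/
def SkelEquiv (k : ℕ) (P : Set E) (Q : Set E') : Prop :=
  Nonempty (skel k P ≃o skel k Q)

end PolytopeDefs

/-- The product of standard simplices `Δ_{n 0} × ⋯ × Δ_{n (r-1)}`. -/
def prodSimplex {r : ℕ} (n : Fin r → ℕ) : Set ((i : Fin r) → Fin (n i + 1) → ℝ) :=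
  Set.univ.pi fun i => stdSimplex ℝ (Fin (n i + 1))

/-- `P` is `(k, n̄)`-prodsimplicial-neighborly: it is a polytope whose `k`-skeleton
is combinatorially equivalent to that of the product of simplices `Δ_n̄`. -/
def IsPSN {E : Type*} [AddCommGroup E] [Module ℝ E] (k : ℕ) {r : ℕ} (n : Fin r → ℕ)
    (P : Set E) : Prop :=
  IsPolytope P ∧ SkelEquiv k P (prodSimplex n)

/-- `P` is `(k, n̄)`-projected-prodsimplicial-neighborly: it is `(k, n̄)`-PSN and moreover
the image under a linear map of a polytope whose poset of all nonempty faces is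
order-isomorphic to that of `Δ_n̄`. -/
def IsPPSN {E : Type*} [AddCommGroup E] [Module ℝ E] (k : ℕ) {r : ℕ} (n : Fin r → ℕ)
    (P : Set E) : Prop :=
  IsPSN k n P ∧ ∃ (N : ℕ) (Q : Set (Fin N → ℝ)) (f : (Fin N → ℝ) →ₗ[ℝ] E),
    IsPolytope Q ∧ P = f '' Q ∧ Nonempty (facesOf Q ≃o facesOf (prodSimplex n))

/-- Ordered simplicial chains mod 2: formal sums of lists of vertices. -/
abbrev ListChain (V : Type*) := List V →₀ ZMod 2

namespace ListChain

variable {V : Type*}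

/-- The join with a vertex. -/
noncomputable def cone (v : V) : ListChain V →ₗ[ZMod 2] ListChain V :=
  Finsupp.lmapDomain _ _ (List.cons v)

/-- The boundary of an ordered simplex (augmented: a vertex has the empty simplex as boundary). -/
noncomputable def bdryList : List V → ListChain V
  | [] => 0
  | v :: l => Finsupp.single l 1 + cone v (bdryList l)

/-- The boundary operator. -/
noncomputable def bdry : ListChain V →ₗ[ZMod 2] ListChain V :=
  Finsupp.linearCombination (ZMod 2) bdryList

/-- The chain map induced by a map of vertices. -/
noncomputable def push (σ : V → V) : ListChain V →ₗ[ZMod 2] ListChain V :=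
  Finsupp.lmapDomain _ _ (List.map σ)

@[simp] lemma cone_single (v : V) (l : List V) :
    cone v (Finsupp.single l 1) = Finsupp.single (v :: l) 1 := by
  simp [cone]

@[simp] lemma push_single (σ : V → V) (l : List V) :
    push σ (Finsupp.single l 1) = Finsupp.single (l.map σ) 1 := by
  simp [push]

@[simp] lemma bdry_single (l : List V) : bdry (Finsupp.single l 1) = bdryList l := by
  simp [bdry]

lemma bdry_cone (v : V) (c : ListChain V) : bdry (cone v c) = c + cone v (bdry c) := by
  have : bdry ∘ₗ cone v = LinearMap.id + cone v ∘ₗ bdry := by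
    ext1 l; ext1; simp [bdryList]
  exact LinearMap.congr_fun this c

lemma bdry_bdryList (l : List V) : bdry (bdryList l) = 0 := by
  induction l with
  | nil => simp [bdryList]
  | cons v l ih => simp [bdryList, bdry_cone, ih, ZModModule.add_self]

lemma bdry_bdry (c : ListChain V) : bdry (bdry c) = 0 := by
  have : bdry ∘ₗ bdry = (0 : ListChain V →ₗ[ZMod 2] ListChain V) := by
    ext1 l; ext1; simp [bdry_bdryList]
  exact LinearMap.congr_fun this c

lemma push_cone (σ : V → V) (v : V) (c : ListChain V) :
    push σ (cone v c) = cone (σ v) (push σ c) := by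
  have : push σ ∘ₗ cone v = cone (σ v) ∘ₗ push σ := by
    ext1 l; ext1; simp
  exact LinearMap.congr_fun this c

lemma push_bdryList (σ : V → V) (l : List V) :
    push σ (bdryList l) = bdryList (l.map σ) := by
  induction l with
  | nil => simp [bdryList]
  | cons v l ih => simp [bdryList, push_cone, ih]

lemma push_bdry (σ : V → V) (c : ListChain V) : push σ (bdry c) = bdry (push σ c) := by
  have : push σ ∘ₗ bdry = bdry ∘ₗ push σ := by
    ext1 l; ext1; simp [push_bdryList]
  exact LinearMap.congr_fun this c

lemma push_push {σ : V → V} (hσ : ∀ v, σ (σ v) = v) (c : ListChain V) :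
    push σ (push σ c) = c := by
  have : push σ ∘ₗ push σ = LinearMap.id := by
    ext1 l; ext1; simp [Function.comp_def, hσ]
  exact LinearMap.congr_fun this c

/-- The cochain `l ↦ s (head l) * φ l`. -/
noncomputable def headMul (s : V → ZMod 2) (φ : ListChain V →ₗ[ZMod 2] ZMod 2) :
    ListChain V →ₗ[ZMod 2] ZMod 2 :=
  Finsupp.linearCombination (ZMod 2) fun l : List V =>
    match l with
    | [] => 0
    | v :: l => s v * φ (Finsupp.single (v :: l) 1)

@[simp] lemma headMul_single_nil (s : V → ZMod 2) (φ : ListChain V →ₗ[ZMod 2] ZMod 2) :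
    headMul s φ (Finsupp.single [] 1) = 0 := by
  simp [headMul]

@[simp] lemma headMul_single_cons (s : V → ZMod 2) (φ : ListChain V →ₗ[ZMod 2] ZMod 2)
    (v : V) (l : List V) :
    headMul s φ (Finsupp.single (v :: l) 1) = s v * φ (Finsupp.single (v :: l) 1) := by
  simp [headMul]

lemma headMul_cone (s : V → ZMod 2) (φ : ListChain V →ₗ[ZMod 2] ZMod 2)
    (v : V) (c : ListChain V) :
    headMul s φ (cone v c) = s v * φ (cone v c) := by
  have : headMul s φ ∘ₗ cone v = s v • (φ ∘ₗ cone v) := by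
    ext1 l; ext1; simp
  exact LinearMap.congr_fun this c

/-- The iterated cup product of the coboundaries of the 0-cochains `s 0, …, s (k - 1)`. -/
noncomputable def cupCobdry (s : ℕ → V → ZMod 2) : ℕ → ListChain V →ₗ[ZMod 2] ZMod 2
  | 0 => Finsupp.linearCombination (ZMod 2) fun l : List V => if l.length = 1 then 1 else 0
  | k + 1 => headMul (s k) (cupCobdry s k) ∘ₗ bdry

lemma cupCobdry_bdry (s : ℕ → V → ZMod 2) (k : ℕ) (c : ListChain V) :
    cupCobdry s k (bdry c) = 0 := by
  cases k with
  | succ k => simp [cupCobdry, bdry_bdry]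
  | zero =>
    have : cupCobdry s 0 ∘ₗ bdry = 0 := by
      ext1 l; ext1
      match l with
      | [] => simp [bdryList]
      | [v] => simp [bdryList, cupCobdry]
      | [u, v] => simp [bdryList, cupCobdry]; decide
      | u :: v :: w :: l =>
        have h : ∀ (x y : V), cupCobdry s 0 ∘ₗ cone x ∘ₗ cone y = 0 := by
          intro x y
          ext1 l; ext1; simp [cupCobdry]
        have h' := LinearMap.congr_fun (h u v) (bdryList (w :: l))
        simp only [LinearMap.comp_apply, LinearMap.zero_apply] at h'
        simp [bdryList] at h' ⊢
        simpa [cupCobdry] using h'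
    exact LinearMap.congr_fun this c

lemma cupCobdry_nil (s : ℕ → V → ZMod 2) (k : ℕ) :
    cupCobdry s k (Finsupp.single [] 1) = 0 := by
  cases k <;> simp [cupCobdry, bdryList]

lemma headMul_push {σ : V → V} {s : V → ZMod 2} (hs : ∀ v, s (σ v) = s v + 1)
    {φ : ListChain V →ₗ[ZMod 2] ZMod 2} (hφ : ∀ c, φ (push σ c) = φ c)
    (hφ0 : φ (Finsupp.single [] 1) = 0) (c : ListChain V) :
    headMul s φ (push σ c) = headMul s φ c + φ c := by
  have : headMul s φ ∘ₗ push σ = headMul s φ + φ := by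
    ext1 l; ext1
    cases l with
    | nil => simp [hφ0]
    | cons v l =>
      have := hφ (Finsupp.single (v :: l) 1)
      simp only [push_single, List.map_cons] at this
      simp [hs, this, add_mul]
  exact LinearMap.congr_fun this c

lemma cupCobdry_push {σ : V → V} {s : ℕ → V → ZMod 2} (hs : ∀ k v, s k (σ v) = s k v + 1)
    (k : ℕ) (c : ListChain V) : cupCobdry s k (push σ c) = cupCobdry s k c := by
  induction k generalizing c with
  | zero =>
    have : cupCobdry s 0 ∘ₗ push σ = cupCobdry s 0 := by
      ext1 l; ext1; simp [cupCobdry]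
    exact LinearMap.congr_fun this c
  | succ k ih =>
    simp only [cupCobdry, LinearMap.comp_apply, ← push_bdry]
    rw [headMul_push (hs k) ih (cupCobdry_nil s k), cupCobdry_bdry, add_zero]

lemma cupCobdry_cons_cons (s : ℕ → V → ZMod 2) (k : ℕ) (u v : V) (l : List V) :
    cupCobdry s (k + 1) (Finsupp.single (u :: v :: l) 1) =
      (s k u + s k v) * cupCobdry s k (Finsupp.single (v :: l) 1) := by
  have h := cupCobdry_bdry s k (Finsupp.single (u :: v :: l) 1)
  simp only [bdry_single, bdryList, map_add, cone_single] at h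
  simp only [cupCobdry, LinearMap.comp_apply, bdry_single, bdryList, map_add, cone_single,
    headMul_single_cons, headMul_cone]
  have h2 : cupCobdry s k (Finsupp.single (u :: l) 1) +
      cupCobdry s k (cone u (cone v (bdryList l))) = cupCobdry s k (Finsupp.single (v :: l) 1) := by
    generalize cupCobdry s k (Finsupp.single (u :: l) 1) = a at *
    generalize cupCobdry s k (cone u (cone v (bdryList l))) = b at *
    generalize cupCobdry s k (Finsupp.single (v :: l) 1) = d at *
    revert h; revert a b d; decide
  rw [← mul_add, h2]; ring

/-- The cup product vanishes on simplices where one of the 0-cochains is constant. -/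
lemma cupCobdry_eq_zero (s : ℕ → V → ZMod 2) {i k : ℕ} (hik : i < k) (l : List V)
    (hl : ∀ u ∈ l, ∀ v ∈ l, s i u = s i v) : cupCobdry s k (Finsupp.single l 1) = 0 := by
  induction k generalizing l with
  | zero => omega
  | succ k ih =>
    match l with
    | [] => exact cupCobdry_nil _ _
    | [v] => simp [cupCobdry, bdryList]
    | u :: v :: l =>
      rw [cupCobdry_cons_cons]
      rcases Nat.lt_succ_iff_lt_or_eq.1 hik with h | rfl
      · rw [ih h, mul_zero]
        exact fun a ha b hb => hl a (List.mem_cons_of_mem _ ha) b (List.mem_cons_of_mem _ hb)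
      · rw [hl u (by simp) v (by simp), CharTwo.add_self_eq_zero, zero_mul]

/-- A tower of chains `g k` with `∂ g (k + 1) = g k + σ g k` detects the iterated cup product. -/
lemma cupCobdry_tower {σ : V → V} {s : ℕ → V → ZMod 2} (hs : ∀ k v, s k (σ v) = s k v + 1)
    {g : ℕ → ListChain V} (hg : ∀ k, bdry (g (k + 1)) = g k + push σ (g k))
    (hg0 : cupCobdry s 0 (g 0) = 1) (k : ℕ) : cupCobdry s k (g k) = 1 := by
  induction k with
  | zero => exact hg0
  | succ k ih =>
    simp only [cupCobdry, LinearMap.comp_apply, hg, map_add]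
    rw [headMul_push (hs k) (cupCobdry_push hs k) (cupCobdry_nil s k), ih, ← add_assoc,
      CharTwo.add_self_eq_zero, zero_add]

/-- Barycentric subdivision of chains of `k`-element lists, with barycentres given by `b`. -/
noncomputable def subdiv (b : List V → V) : ℕ → ListChain V →ₗ[ZMod 2] ListChain V
  | 0 => LinearMap.id
  | k + 1 => Finsupp.linearCombination (ZMod 2) fun l => cone (b l) (subdiv b k (bdryList l))

lemma bdry_subdiv (b : List V → V) (k : ℕ) (c : ListChain V) :
    bdry (subdiv b (k + 1) c) = subdiv b k (bdry c) := by
  induction k generalizing c with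
  | zero =>
    have : bdry ∘ₗ subdiv b 1 = subdiv b 0 ∘ₗ bdry := by
      ext1 l; ext1; simp [subdiv, bdry_cone, bdry_bdryList]
    exact LinearMap.congr_fun this c
  | succ k ih =>
    have : bdry ∘ₗ subdiv b (k + 2) = subdiv b (k + 1) ∘ₗ bdry := by
      ext1 l; ext1
      have h := ih (bdryList l)
      rw [bdry_bdryList, map_zero] at h
      have h2 : subdiv b (k + 2) (Finsupp.single l 1) =
        cone (b l) (subdiv b (k + 1) (bdryList l)) := by simp [subdiv]
      simp [h2, bdry_cone, h]
    exact LinearMap.congr_fun this c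

lemma push_subdiv {b : List V → V} {σ : V → V} (hb : ∀ l, l ≠ [] → b (l.map σ) = σ (b l)) (k : ℕ)
    (c : ListChain V) : push σ (subdiv b k c) = subdiv b k (push σ c) := by
  induction k generalizing c with
  | zero => rfl
  | succ k ih =>
    have : push σ ∘ₗ subdiv b (k + 1) = subdiv b (k + 1) ∘ₗ push σ := by
      ext1 l; ext1
      cases l with
      | nil => simp [subdiv, bdryList]
      | cons v l => simp [subdiv, push_cone, hb, ih, push_bdryList, -List.map_cons]
    exact LinearMap.congr_fun this c

/-- The chains spanned by the simplices with property `p`. -/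
noncomputable def spannedBy (p : List V → Prop) : Submodule (ZMod 2) (ListChain V) :=
  Submodule.span _ ((fun l => Finsupp.single l 1) '' {l | p l})

lemma single_mem_spannedBy {p : List V → Prop} {l : List V} (h : p l) :
    Finsupp.single l 1 ∈ spannedBy p := Submodule.subset_span ⟨l, h, rfl⟩

lemma map_mem_of_mem_spannedBy {M : Type*} [AddCommGroup M] [Module (ZMod 2) M]
    {p : List V → Prop} {S : Submodule (ZMod 2) M} (φ : ListChain V →ₗ[ZMod 2] M)
    (h : ∀ l, p l → φ (Finsupp.single l 1) ∈ S) {c : ListChain V}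
    (hc : c ∈ spannedBy p) : φ c ∈ S := by
  have : spannedBy p ≤ S.comap φ := by
    refine Submodule.span_le.2 ?_
    rintro _ ⟨l, hl, rfl⟩
    exact h l hl
  exact this hc

lemma bdryList_mem (l : List V) :
    bdryList l ∈ spannedBy fun l' => l'.length + 1 = l.length ∧ l' ⊆ l := by
  induction l with
  | nil => simp [bdryList]
  | cons v l ih =>
    refine add_mem (single_mem_spannedBy ⟨rfl, List.subset_cons_self v l⟩) ?_
    refine map_mem_of_mem_spannedBy (cone v) (fun l' hl' => ?_) ih
    rw [cone_single]
    exact single_mem_spannedBy ⟨by simp [hl'.1], List.cons_subset_cons v hl'.2⟩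

end ListChain

section Borsuk

open ListChain

/-- Points with a formal sign; the sign makes the antipodal map fixed point free. -/
abbrev SignedPoint (E : Type*) := E × ZMod 2

namespace SignedPoint

variable {E : Type*} [NormedAddCommGroup E]

/-- The antipodal map. -/
def antipode (v : SignedPoint E) : SignedPoint E := (-v.1, v.2 + 1)

lemma antipode_antipode (v : SignedPoint E) : antipode (antipode v) = v := by
  ext
  · simp [antipode]
  · simp only [antipode]; generalize v.2 = a; revert a; decide

/-- The `k`-dimensional hemisphere of the boundary of the cross-polytope with vertices `± e j`. -/
noncomputable def hemisphere (e : ℕ → E) : ℕ → ListChain (SignedPoint E)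
  | 0 => Finsupp.single [(e 0, 0)] 1
  | k + 1 => cone (e (k + 1), 0) (hemisphere e k + push antipode (hemisphere e k))

lemma bdry_hemisphere (e : ℕ → E) (k : ℕ) :
    bdry (hemisphere e (k + 1)) = hemisphere e k + push antipode (hemisphere e k) := by
  rw [hemisphere, bdry_cone]
  suffices h : bdry (hemisphere e k + push antipode (hemisphere e k)) = 0 by
    rw [h, map_zero, add_zero]
  rw [map_add, ← push_bdry]
  cases k with
  | zero => simp [hemisphere, bdryList, ZModModule.add_self]
  | succ k =>
    rw [bdry_hemisphere e k, map_add, push_push antipode_antipode, add_comm (push antipode _),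
      ZModModule.add_self]

variable [NormedSpace ℝ E]

/-- The average of a list of points, with the sign of its first element. -/
noncomputable def bary (l : List (SignedPoint E)) : SignedPoint E :=
  ((l.length : ℝ)⁻¹ • (l.map Prod.fst).sum, (l.head?.map Prod.snd).getD 0)

lemma bary_antipode (l : List (SignedPoint E)) (hl : l ≠ []) :
    bary (l.map antipode) = antipode (bary l) := by
  have h : ∀ l : List (SignedPoint E),
      ((l.map antipode).map Prod.fst).sum = -(l.map Prod.fst).sum := by
    intro l
    induction l with
    | nil => simp
    | cons v l ih => simp only [List.map_cons, List.sum_cons, ih, antipode]; abel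
  cases l with
  | nil => exact absurd rfl hl
  | cons v l =>
    ext
    · simp only [bary, antipode, h, List.length_map, smul_neg]
    · simp [bary, antipode]

lemma bary_singleton (v : SignedPoint E) : bary [v] = v := by
  ext <;> simp [bary]

lemma bary_mem {C : Set E} (hC : Convex ℝ C) (l : List (SignedPoint E)) (hl : l ≠ [])
    (h : ∀ v ∈ l, v.1 ∈ C) : (bary l).1 ∈ C := by
  have hlen : (l.length : ℝ) ≠ 0 := by simpa using hl
  have : (bary l).1 = ∑ i : Fin l.length, (l.length : ℝ)⁻¹ • (l[i]).1 := by
    rw [← Finset.smul_sum]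
    simp only [bary]
    congr 1
    rw [← Fin.sum_univ_fun_getElem]
    simp
  rw [this]
  exact hC.sum_mem (fun _ _ => by positivity) (by simp [hlen])
    fun i _ => h _ (List.getElem_mem _)

lemma dist_bary_le {D : ℝ} (hD : 0 ≤ D) {N : ℕ} (l : List (SignedPoint E)) (hN : l.length ≤ N)
    (h : ∀ u ∈ l, ∀ v ∈ l, dist u.1 v.1 ≤ D) {v : SignedPoint E} (hv : v ∈ l) :
    dist v.1 (bary l).1 ≤ (1 - (N : ℝ)⁻¹) * D := by
  have hpos : 0 < l.length := List.length_pos_of_mem hv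
  have hpos' : (0 : ℝ) < l.length := by exact_mod_cast hpos
  have hsum : ∀ l' : List (SignedPoint E), (∀ u ∈ l', dist u.1 v.1 ≤ D) →
      ‖(l'.map Prod.fst).sum - (l'.length : ℝ) • v.1‖ ≤ l'.length * D := by
    intro l'
    induction l' with
    | nil => simp
    | cons u l' ih =>
      intro hu
      have h1 := ih fun a ha => hu a (List.mem_cons_of_mem _ ha)
      have h2 := hu u (by simp)
      rw [dist_eq_norm] at h2
      have : ((u :: l').map Prod.fst).sum - ((u :: l').length : ℝ) • v.1 =
          (u.1 - v.1) + ((l'.map Prod.fst).sum - (l'.length : ℝ) • v.1) := by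
        simp only [List.map_cons, List.sum_cons, List.length_cons, Nat.cast_add, Nat.cast_one]
        module
      rw [this]
      refine (norm_add_le _ _).trans ?_
      push_cast [List.length_cons]
      linarith
  obtain ⟨l₁, l₂, rfl⟩ := List.append_of_mem hv
  have h1 := hsum (l₁ ++ l₂) fun u hu => h u (by
    simp only [List.mem_append, List.mem_cons] at hu ⊢; tauto) v hv
  have hle : (((l₁ ++ v :: l₂).length : ℕ) : ℝ) = ((l₁ ++ l₂).length : ℝ) + 1 := by
    simp; ring
  set m : ℝ := ((l₁ ++ v :: l₂).length : ℝ) with hm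
  have h2 : (bary (l₁ ++ v :: l₂)).1 - v.1 =
      m⁻¹ • (((l₁ ++ l₂).map Prod.fst).sum - ((l₁ ++ l₂).length : ℝ) • v.1) := by
    have h3 : ((l₁ ++ v :: l₂).map Prod.fst).sum = ((l₁ ++ l₂).map Prod.fst).sum + v.1 := by
      simp; abel
    have h4 : ((l₁ ++ l₂).length : ℝ) = m - 1 := by linarith
    simp only [bary]
    rw [← hm, h3, h4]
    have h5 : v.1 = m⁻¹ • m • v.1 := by rw [smul_smul, inv_mul_cancel₀ hpos'.ne', one_smul]
    nth_rewrite 2 [h5]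
    module
  rw [dist_comm, dist_eq_norm, h2, norm_smul, norm_inv, Real.norm_of_nonneg hpos'.le]
  have hmN : m ≤ N := by rw [hm]; exact_mod_cast hN
  have hinv : (N : ℝ)⁻¹ ≤ m⁻¹ := inv_anti₀ hpos' hmN
  calc m⁻¹ * _ ≤ m⁻¹ * (((l₁ ++ l₂).length : ℝ) * D) := by gcongr
    _ = (1 - m⁻¹) * D := by
        have : ((l₁ ++ l₂).length : ℝ) = m - 1 := by linarith
        rw [this]; field_simp
    _ ≤ (1 - (N : ℝ)⁻¹) * D := by gcongr

/-- Simplices with `k` vertices in `C` at mutual distance at most `D`. -/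
def IsSmall (k : ℕ) (D : ℝ) (C : Set E) (l : List (SignedPoint E)) : Prop :=
  l.length = k ∧ (∀ v ∈ l, v.1 ∈ C) ∧ ∀ u ∈ l, ∀ v ∈ l, dist u.1 v.1 ≤ D

lemma subdiv_mem {D : ℝ} (hD : 0 ≤ D) {N : ℕ} (k : ℕ) (hk : k ≤ N) (C : Set E)
    (hC : Convex ℝ C) (l : List (SignedPoint E)) (hl : IsSmall k D C l) :
    subdiv bary k (Finsupp.single l 1) ∈ spannedBy (IsSmall k ((1 - (N : ℝ)⁻¹) * D) C) := by
  induction k generalizing l C with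
  | zero =>
    obtain rfl : l = [] := List.eq_nil_of_length_eq_zero hl.1
    exact single_mem_spannedBy ⟨rfl, by simp, by simp⟩
  | succ k ih =>
    have hne : l ≠ [] := by rintro rfl; simpa using hl.1
    have hr : 0 ≤ (1 - (N : ℝ)⁻¹) * D := by
      have : (N : ℝ)⁻¹ ≤ 1 := inv_le_one_of_one_le₀ (by exact_mod_cast (by omega : 1 ≤ N))
      exact mul_nonneg (by linarith) hD
    set r := (1 - (N : ℝ)⁻¹) * D
    have hb : ∀ v ∈ l, v.1 ∈ C ∩ Metric.closedBall (bary l).1 r := fun v hv =>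
      ⟨hl.2.1 v hv, dist_bary_le hD l (hl.1.trans_le hk) hl.2.2 hv⟩
    have h1 : subdiv bary k (bdryList l) ∈
        spannedBy (IsSmall k r (C ∩ Metric.closedBall (bary l).1 r)) := by
      refine map_mem_of_mem_spannedBy _ (fun l' hl' => ?_) (bdryList_mem l)
      refine ih (by omega) _ (hC.inter (convex_closedBall _ _)) l' ⟨?_, ?_, ?_⟩
      · have := hl.1; omega
      · exact fun v hv => hb v (hl'.2 hv)
      · exact fun u hu v hv => hl.2.2 u (hl'.2 hu) v (hl'.2 hv)
    have h2 : subdiv bary (k + 1) (Finsupp.single l 1) =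
        cone (bary l) (subdiv bary k (bdryList l)) := by simp [subdiv]
    rw [h2]
    refine map_mem_of_mem_spannedBy _ (fun l' hl' => ?_) h1
    rw [cone_single]
    refine single_mem_spannedBy ⟨by simp [hl'.1], ?_, ?_⟩
    · simp only [List.mem_cons, forall_eq_or_imp]
      exact ⟨bary_mem hC l hne hl.2.1, fun v hv => (hl'.2.1 v hv).1⟩
    · simp only [List.mem_cons, forall_eq_or_imp]
      refine ⟨⟨by simpa using hr, fun v hv => ?_⟩, fun u hu => ⟨?_, fun v hv => hl'.2.2 u hu v hv⟩⟩
      · rw [dist_comm]; exact (hl'.2.1 v hv).2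
      · exact (hl'.2.1 u hu).2

lemma subdiv_iterate_mem {D : ℝ} (hD : 0 ≤ D) {k : ℕ} (hk : 1 ≤ k) {C : Set E}
    (hC : Convex ℝ C) (m : ℕ) {l : List (SignedPoint E)} (hl : IsSmall k D C l) :
    (subdiv bary k)^[m] (Finsupp.single l 1) ∈
      spannedBy (IsSmall k ((1 - (k : ℝ)⁻¹) ^ m * D) C) := by
  induction m with
  | zero => simpa using single_mem_spannedBy hl
  | succ m ih =>
    have h1 : (k : ℝ)⁻¹ ≤ 1 := inv_le_one_of_one_le₀ (by exact_mod_cast hk)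
    rw [Function.iterate_succ_apply', pow_succ', mul_assoc]
    refine map_mem_of_mem_spannedBy _ (fun l' hl' => ?_) ih
    exact subdiv_mem (mul_nonneg (pow_nonneg (by linarith) m) hD) k le_rfl C hC l' hl'

lemma hemisphere_mem (e : ℕ → E) (k : ℕ) :
    hemisphere e k ∈ spannedBy fun l : List (SignedPoint E) => l.length = k + 1 ∧
      ∃ ε : ℕ → ℝ, (∀ j, ε j = 1 ∨ ε j = -1) ∧ ∀ v ∈ l, ∃ j ≤ k, v.1 = ε j • e j := by
  induction k with
  | zero =>
    exact single_mem_spannedBy ⟨rfl, fun _ => 1, by simp, by simp⟩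
  | succ k ih =>
    refine map_mem_of_mem_spannedBy (cone _) (p := fun l : List (SignedPoint E) =>
      l.length = k + 1 ∧ ∃ ε : ℕ → ℝ, (∀ j, ε j = 1 ∨ ε j = -1) ∧
        ∀ v ∈ l, ∃ j ≤ k, v.1 = ε j • e j) ?_ (add_mem ih (map_mem_of_mem_spannedBy _ ?_ ih))
    · rintro l ⟨hl, ε, hε, h⟩
      rw [cone_single]
      refine single_mem_spannedBy ⟨by simp [hl], fun j => if j ≤ k then ε j else 1, ?_, ?_⟩
      · intro j; dsimp only; split_ifs; exacts [hε j, Or.inl rfl]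
      · simp only [List.mem_cons, forall_eq_or_imp]
        refine ⟨⟨k + 1, le_rfl, by simp⟩, fun v hv => ?_⟩
        obtain ⟨j, hj, h'⟩ := h v hv
        exact ⟨j, by omega, by simp [hj, h']⟩
    · rintro l ⟨hl, ε, hε, h⟩
      rw [push_single]
      refine single_mem_spannedBy ⟨by simp [hl], fun j => -ε j, ?_, ?_⟩
      · intro j; rcases hε j with h | h <;> simp [h]
      · simp only [List.mem_map, forall_exists_index, and_imp, forall_apply_eq_imp_iff₂]
        intro v hv
        obtain ⟨j, hj, h'⟩ := h v hv
        exact ⟨j, hj, by simp [antipode, h']⟩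

end SignedPoint

open SignedPoint

/-- The Lyusternik–Shnirelman form of the Borsuk–Ulam theorem: `n` pairs of disjoint
antipodal open sets do not cover `ℝⁿ⁺¹ \ {0}`. -/
theorem exists_ne_zero_notMem_of_isOpen {n : ℕ} (U : Fin n → Set (Fin (n + 1) → ℝ))
    (hU : ∀ i, IsOpen (U i)) (hdisj : ∀ i x, x ∈ U i → -x ∉ U i) :
    ∃ w ≠ 0, ∀ i, w ∉ U i ∧ -w ∉ U i := by
  classical
  by_contra! hcon
  let K : Set (Fin (n + 1) → ℝ) := {x | ∑ i, |x i| = 1}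
  have hK1 : ∀ x ∈ K, ‖x‖ ≤ 1 := fun x hx => by
    rw [pi_norm_le_iff_of_nonneg zero_le_one]
    intro i
    rw [Real.norm_eq_abs]
    exact (Finset.single_le_sum (f := fun i => |x i|) (fun _ _ => abs_nonneg _)
      (Finset.mem_univ i)).trans_eq hx
  have hK : IsCompact K := by
    refine Metric.isCompact_of_isClosed_isBounded
      (isClosed_eq (by fun_prop) continuous_const) ?_
    exact isBounded_iff_forall_norm_le.2 ⟨1, hK1⟩
  have hK0 : ∀ x ∈ K, x ≠ 0 := by
    rintro x hx rfl
    simp [K] at hx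
  obtain ⟨δ, hδ, hδK⟩ := lebesgue_number_lemma_of_metric (s := K)
    (c := fun p : Fin n × Bool => if p.2 then U p.1 else -U p.1) hK
    (fun p => by
      split_ifs
      exacts [hU _, (hU _).neg])
    (fun x hx => by
      rw [mem_iUnion]
      by_contra! h
      have hx0 := hK0 x hx
      obtain ⟨i, hi⟩ := hcon x hx0
      have h1 := h (i, true)
      have h2 := h (i, false)
      simp at h1 h2
      exact h2 (hi h1))
  let s : ℕ → SignedPoint (Fin (n + 1) → ℝ) → ZMod 2 := fun k v =>
    if h : k < n then (if v.1 ∈ U ⟨k, h⟩ then 0 else if -v.1 ∈ U ⟨k, h⟩ then 1 else v.2) else v.2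
  have hs : ∀ k v, s k (antipode v) = s k v + 1 := by
    intro k v
    simp only [s, antipode, neg_neg]
    split_ifs with h h1 h2
    · exact absurd h1 (hdisj _ _ h2)
    · decide
    · simp
    · rfl
    · rfl
  let e : ℕ → (Fin (n + 1) → ℝ) := fun j => if h : j < n + 1 then Pi.single ⟨j, h⟩ 1 else 0
  obtain ⟨m, hm⟩ : ∃ m : ℕ, (1 - ((n + 1 : ℕ) : ℝ)⁻¹) ^ m * 2 < δ := by
    have h1 : ((n + 1 : ℕ) : ℝ)⁻¹ ≤ 1 := inv_le_one_of_one_le₀ (by simp)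
    have h0 : (0 : ℝ) < ((n + 1 : ℕ) : ℝ)⁻¹ := by positivity
    have := (tendsto_pow_atTop_nhds_zero_of_lt_one (sub_nonneg.2 h1)
      (by linarith)).mul_const 2
    rw [zero_mul] at this
    exact (this.eventually (gt_mem_nhds hδ)).exists
  let g : ℕ → ListChain (SignedPoint (Fin (n + 1) → ℝ)) := fun k =>
    (subdiv bary (k + 1))^[m] (hemisphere e k)
  have hg : ∀ k, bdry (g (k + 1)) = g k + push antipode (g k) := by
    intro k
    have h1 : ∀ m c, bdry ((subdiv bary (k + 2))^[m] c) =
        (subdiv (V := SignedPoint (Fin (n + 1) → ℝ)) bary (k + 1))^[m] (bdry c) := by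
      intro m c
      induction m with
      | zero => rfl
      | succ m ih => rw [Function.iterate_succ_apply', bdry_subdiv, ih,
          Function.iterate_succ_apply']
    have h2 : ∀ m c, push antipode ((subdiv bary (k + 1))^[m] c) =
        (subdiv (V := SignedPoint (Fin (n + 1) → ℝ)) bary (k + 1))^[m] (push antipode c) := by
      intro m c
      induction m with
      | zero => rfl
      | succ m ih => rw [Function.iterate_succ_apply', push_subdiv bary_antipode, ih,
          Function.iterate_succ_apply']
    simp only [g]
    rw [h1, bdry_hemisphere, h2, iterate_map_add]
  have hg0 : cupCobdry s 0 (g 0) = 1 := by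
    have h1 : subdiv bary 1 (hemisphere e 0) = hemisphere e 0 := by
      simp [subdiv, hemisphere, bdryList, bary_singleton]
    have h2 : g 0 = hemisphere e 0 := Function.iterate_fixed h1 m
    rw [h2]
    simp [hemisphere, cupCobdry]
  have h1 := cupCobdry_tower hs hg hg0 n
  suffices h : cupCobdry s n (g n) ∈ (⊥ : Submodule (ZMod 2) (ZMod 2)) by
    rw [Submodule.mem_bot, h1] at h
    exact one_ne_zero h
  suffices h : ∀ l : List (SignedPoint (Fin (n + 1) → ℝ)),
      IsSmall (n + 1) ((1 - ((n + 1 : ℕ) : ℝ)⁻¹) ^ m * 2) K l →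
        cupCobdry s n (Finsupp.single l 1) = 0 by
    have hmem : g n ∈ spannedBy (IsSmall (n + 1) ((1 - ((n + 1 : ℕ) : ℝ)⁻¹) ^ m * 2) K) := by
      have hit : ∀ c, (subdiv bary (n + 1))^[m] c = ((subdiv bary (n + 1)) ^ m :
        Module.End (ZMod 2) (ListChain (SignedPoint (Fin (n + 1) → ℝ)))) c := fun c => by
          rw [Module.End.pow_apply]
      simp only [g]
      rw [hit]
      refine map_mem_of_mem_spannedBy _ ?_ (hemisphere_mem e n)
      rintro l ⟨hl, ε, hε, hv⟩
      let C : Set (Fin (n + 1) → ℝ) := {x | (∀ i : Fin (n + 1), 0 ≤ ε i * x i) ∧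
        ∑ i : Fin (n + 1), ε i * x i = 1}
      have hCK : C ⊆ K := by
        rintro x ⟨h0, h1⟩
        simp only [K, mem_ofPred_eq]
        rw [← h1]
        refine Finset.sum_congr rfl fun i _ => ?_
        rw [← abs_of_nonneg (h0 i), abs_mul]
        rcases hε i with h | h <;> simp [h]
      have hC : Convex ℝ C := by
        rintro x ⟨hx0, hx1⟩ y ⟨hy0, hy1⟩ a b ha hb hab
        refine ⟨fun i => ?_, ?_⟩
        · have := add_nonneg (mul_nonneg ha (hx0 i)) (mul_nonneg hb (hy0 i))
          simp only [Pi.add_apply, Pi.smul_apply, smul_eq_mul]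
          linarith
        · have : ∀ i : Fin (n + 1), ε i * (a • x + b • y) i =
              a * (ε i * x i) + b * (ε i * y i) := fun i => by
            simp only [Pi.add_apply, Pi.smul_apply, smul_eq_mul]; ring
          simp only [this, Finset.sum_add_distrib, ← Finset.mul_sum, hx1, hy1]
          linarith
      have hlC : ∀ v ∈ l, v.1 ∈ C := by
        intro v hvl
        obtain ⟨j, hj, h⟩ := hv v hvl
        have hj' : j < n + 1 := by omega
        have hsq : ε j * ε j = 1 := by rcases hε j with h | h <;> simp [h]
        have hval : ∀ i : Fin (n + 1), ε i * v.1 i = if i = ⟨j, hj'⟩ then 1 else 0 := by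
          intro i
          simp only [h, e, hj', dif_pos, Pi.smul_apply, Pi.single_apply, smul_eq_mul]
          split_ifs with hi
          · rw [hi, mul_one, hsq]
          · simp
        refine ⟨fun i => ?_, ?_⟩
        · rw [hval]; split_ifs <;> norm_num
        · simp [hval]
      have hsmall : IsSmall (n + 1) 2 C l := by
        refine ⟨hl, hlC, fun u hu v hv => ?_⟩
        have h1 := hK1 _ (hCK (hlC u hu))
        have h2 := hK1 _ (hCK (hlC v hv))
        have := dist_le_norm_add_norm u.1 v.1
        linarith
      rw [← hit]
      refine Submodule.span_mono (Set.image_mono fun l' hl' => ?_)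
        (subdiv_iterate_mem zero_le_two (by omega) hC m hsmall)
      exact ⟨hl'.1, fun v hv => hCK (hl'.2.1 v hv), hl'.2.2⟩
    exact map_mem_of_mem_spannedBy _ (fun l hl => (Submodule.mem_bot _).2 (h l hl)) hmem
  rintro l ⟨hl, hlK, hld⟩
  obtain ⟨v, l', rfl⟩ := List.exists_cons_of_length_eq_add_one hl
  obtain ⟨⟨i, b⟩, hball⟩ := hδK v.1 (hlK v (by simp))
  have hmem : ∀ u ∈ v :: l', u.1 ∈ (if b then U i else -U i) := fun u hu =>
    hball (Metric.mem_ball.2 ((hld u hu v (by simp)).trans_lt hm))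
  refine cupCobdry_eq_zero s i.2 _ ?_
  suffices h : ∀ u ∈ v :: l', s i u = if b then 0 else 1 from
    fun u hu w hw => (h u hu).trans (h w hw).symm
  intro u hu
  have := hmem u hu
  cases b with
  | true => simp only [if_true] at this; simp [s, this]
  | false =>
    simp only [Bool.false_eq_true, if_false, Set.mem_neg] at this
    have h2 : u.1 ∉ U i := fun h => hdisj i _ h this
    simp [s, this, h2]

end Borsuk

section HamSandwich

variable {W : Type*} [AddCommGroup W] [Module ℝ W] {J : Type*}

/-- The functionals of a finite family which are positive at `w`. -/
noncomputable def positiveAt (ℓ : J → W →ₗ[ℝ] ℝ) (S : Finset J) (w : W) : Finset J :=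
  S.filter fun j => 0 < ℓ j w

lemma mem_positiveAt {ℓ : J → W →ₗ[ℝ] ℝ} {S : Finset J} {w : W} {j : J} :
    j ∈ positiveAt ℓ S w ↔ j ∈ S ∧ 0 < ℓ j w := by
  simp [positiveAt]

lemma card_positiveAt_add_card_positiveAt_neg (ℓ : J → W →ₗ[ℝ] ℝ) (S : Finset J) (w : W) :
    (positiveAt ℓ S w).card + (positiveAt ℓ S (-w)).card ≤ S.card := by
  classical
  rw [← Finset.card_union_of_disjoint]
  · refine Finset.card_le_card (Finset.union_subset ?_ ?_) <;> exact Finset.filter_subset _ _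
  · rw [Finset.disjoint_left]
    intro j h1 h2
    rw [mem_positiveAt] at h1 h2
    have := h2.2
    rw [map_neg] at this
    linarith [h1.2]

lemma isOpen_setOf_card_lt {n : ℕ} (ℓ : J → (Fin n → ℝ) →ₗ[ℝ] ℝ) (S : Finset J) :
    IsOpen {x | S.card < 2 * (positiveAt ℓ S x).card} := by
  have : {x | S.card < 2 * (positiveAt ℓ S x).card} =
      ⋃ T ∈ {T : Finset J | T ⊆ S ∧ S.card < 2 * T.card}, ⋂ j ∈ T, {x | 0 < ℓ j x} := by
    ext x
    simp only [Set.mem_ofPred_eq, mem_iUnion, mem_iInter, exists_prop]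
    constructor
    · intro h
      exact ⟨positiveAt ℓ S x, ⟨Finset.filter_subset _ _, h⟩, fun j hj => (mem_positiveAt.1 hj).2⟩
    · rintro ⟨T, ⟨hTS, hT⟩, h⟩
      have : T.card ≤ (positiveAt ℓ S x).card :=
        Finset.card_le_card fun j hj => mem_positiveAt.2 ⟨hTS hj, h j hj⟩
      omega
  rw [this]
  refine isOpen_biUnion fun T _ => isOpen_biInter_finset fun j _ => ?_
  exact isOpen_lt continuous_const (ℓ j).continuous_of_finiteDimensional

lemma exists_balanced_fin {n : ℕ} (S : Fin (n + 1) → Finset J)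
    (ℓ : J → (Fin (n + 1) → ℝ) →ₗ[ℝ] ℝ) :
    ∃ w ≠ 0, ∀ c, 2 * (positiveAt ℓ (S c) w).card ≤ (S c).card := by
  obtain ⟨w, hw, h⟩ := exists_ne_zero_notMem_of_isOpen
    (fun i : Fin n => {x | (S i.castSucc).card < 2 * (positiveAt ℓ (S i.castSucc) x).card})
    (fun i => isOpen_setOf_card_lt ℓ _)
    (fun i x hx hx' => by
      have := card_positiveAt_add_card_positiveAt_neg ℓ (S i.castSucc) x
      simp only [Set.mem_ofPred_eq] at hx hx'
      omega)
  simp only [Set.mem_ofPred_eq, not_lt] at h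
  have hlast := card_positiveAt_add_card_positiveAt_neg ℓ (S (Fin.last n)) w
  by_cases h' : 2 * (positiveAt ℓ (S (Fin.last n)) w).card ≤ (S (Fin.last n)).card
  · exact ⟨w, hw, fun c => Fin.lastCases h' (fun i => (h i).1) c⟩
  · refine ⟨-w, neg_ne_zero.2 hw, fun c => Fin.lastCases ?_ (fun i => (h i).2) c⟩
    omega

/-- A discrete ham sandwich theorem: if the linear functionals on `W` are distributed among at most
`dim W` classes, then some nonzero vector is positive on at most half of each class. -/
theorem exists_ne_zero_two_mul_card_positiveAt_le [FiniteDimensional ℝ W] {K : Type*} [Fintype K]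
    (hW : 0 < Module.finrank ℝ W) (hK : Fintype.card K ≤ Module.finrank ℝ W)
    (S : K → Finset J) (ℓ : J → W →ₗ[ℝ] ℝ) :
    ∃ w ≠ 0, ∀ c, 2 * (positiveAt ℓ (S c) w).card ≤ (S c).card := by
  classical
  obtain ⟨n, hn⟩ := Nat.exists_eq_succ_of_ne_zero hW.ne'
  let φ : (Fin (n + 1) → ℝ) ≃ₗ[ℝ] W := LinearEquiv.ofFinrankEq _ _ (by simp [hn])
  obtain ⟨f⟩ : Nonempty (K ↪ Fin (n + 1)) :=
    Function.Embedding.nonempty_of_card_le (by simpa [hn] using hK)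
  obtain ⟨w, hw, h⟩ := exists_balanced_fin (Function.extend f S fun _ => ∅)
    (fun j => ℓ j ∘ₗ φ.toLinearMap)
  refine ⟨φ w, by simpa using hw, fun c => ?_⟩
  have := h (f c)
  rw [f.injective.extend_apply] at this
  exact this

end HamSandwich

section BoxFace

variable {ι : Type*} {α : ι → Type*}

/-- The nonempty faces of a product of simplices with vertex sets `α i`, encoded by their sets of
vertices in the factors. -/
abbrev BoxFace (α : ι → Type*) := {S : Finset (Σ i, α i) // ∀ i, ∃ a, (⟨i, a⟩ : Σ i, α i) ∈ S}

namespace BoxFace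

variable [Fintype ι] [DecidableEq ι] [∀ i, DecidableEq (α i)]

/-- The face consisting of a single vertex. -/
def vertex (s : ∀ i, α i) : BoxFace α :=
  ⟨Finset.univ.image fun i => ⟨i, s i⟩, fun i => ⟨s i, by simp⟩⟩

lemma mem_vertex {s : ∀ i, α i} {p : Σ i, α i} : p ∈ (vertex s).1 ↔ p.2 = s p.1 := by
  obtain ⟨i, a⟩ := p
  simp only [vertex, Finset.mem_image, Finset.mem_univ, true_and, Sigma.mk.injEq]
  constructor
  · rintro ⟨j, rfl, h⟩
    exact (eq_of_heq h).symm
  · rintro rfl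
    exact ⟨i, rfl, HEq.rfl⟩

lemma card_vertex (s : ∀ i, α i) : (vertex s).1.card = Fintype.card ι := by
  rw [vertex, Finset.card_image_of_injective _ fun i j h => congrArg Sigma.fst h, Finset.card_univ]

lemma vertex_le_iff {s : ∀ i, α i} {S : BoxFace α} : vertex s ≤ S ↔ ∀ i, ⟨i, s i⟩ ∈ S.1 := by
  constructor
  · intro h i
    exact h (mem_vertex.2 rfl)
  · rintro h ⟨i, a⟩ hp
    obtain rfl : a = s i := mem_vertex.1 hp
    exact h i

lemma exists_vertex_le (S : BoxFace α) : ∃ s, vertex s ≤ S := by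
  choose s hs using S.2
  exact ⟨s, vertex_le_iff.2 hs⟩

lemma vertex_update_le {s : ∀ i, α i} {S : BoxFace α} (hs : vertex s ≤ S) {p : Σ i, α i}
    (hp : p ∈ S.1) : vertex (Function.update s p.1 p.2) ≤ S := by
  rw [vertex_le_iff] at hs ⊢
  intro i
  rcases eq_or_ne i p.1 with rfl | h
  · simpa using hp
  · simpa [h] using hs i

lemma exists_vertex_le_of_mem {S : BoxFace α} {p : Σ i, α i} (hp : p ∈ S.1) :
    ∃ s, vertex s ≤ S ∧ s p.1 = p.2 := by
  obtain ⟨s, hs⟩ := exists_vertex_le S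
  exact ⟨_, vertex_update_le hs hp, by simp⟩

lemma vertex_le_vertex {s t : ∀ i, α i} (h : vertex s ≤ vertex t) : s = t :=
  funext fun i => mem_vertex.1 (vertex_le_iff.1 h i)

lemma eq_vertex_of_le_vertex {S : BoxFace α} {s : ∀ i, α i} (h : S ≤ vertex s) :
    S = vertex s := by
  obtain ⟨t, ht⟩ := exists_vertex_le S
  obtain rfl := vertex_le_vertex (ht.trans h)
  exact le_antisymm h ht

lemma card_le (S : BoxFace α) : Fintype.card ι ≤ S.1.card := by
  obtain ⟨s, hs⟩ := exists_vertex_le S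
  exact (card_vertex s).symm.trans_le (Finset.card_le_card hs)

/-- Enlarging a face by one vertex of one factor. -/
def insert (p : Σ i, α i) (S : BoxFace α) : BoxFace α :=
  ⟨Insert.insert p S.1, fun i => (S.2 i).imp fun _ h => Finset.mem_insert_of_mem h⟩

end BoxFace

/-- A family of pairwise disjoint nonempty subsets of a set with no more elements than the family
has members consists of singletons. -/
lemma Finset.card_eq_one_of_pairwiseDisjoint {κ β : Type*} [DecidableEq β] {I : Finset κ}
    {A : κ → Finset β} {T : Finset β} (hA : ∀ i ∈ I, (A i).Nonempty) (hT : ∀ i ∈ I, A i ⊆ T)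
    (hdisj : (I : Set κ).PairwiseDisjoint A) (hcard : T.card ≤ I.card) {i : κ} (hi : i ∈ I) :
    (A i).card = 1 := by
  have h1 : ∀ i ∈ I, 1 ≤ (A i).card := fun i hi => Finset.card_pos.2 (hA i hi)
  have h2 : ∑ i ∈ I, (A i).card ≤ ∑ i ∈ I, 1 := by
    rw [← Finset.card_biUnion hdisj, Finset.sum_const, smul_eq_mul, mul_one]
    exact (Finset.card_le_card (Finset.biUnion_subset.2 hT)).trans hcard
  exact ((Finset.sum_eq_sum_iff_of_le h1).1 (le_antisymm (Finset.sum_le_sum h1) h2) i hi).symm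

namespace BoxFace

variable [Fintype ι] [DecidableEq ι] [∀ i, DecidableEq (α i)] [∀ i, Fintype (α i)]

lemma card_image_vertex {k : ℕ} {ψ : {S : BoxFace α // S.1.card ≤ k} → BoxFace α}
    (hmeet : ∀ S T B, B ≤ ψ S → B ≤ ψ T → ∃ U, U ≤ S ∧ U ≤ T ∧ B ≤ ψ U)
    (hk : Fintype.card ι ≤ k) (s : ∀ i, α i) :
    (ψ ⟨vertex s, (card_vertex s).trans_le hk⟩).1.card = Fintype.card ι := by
  classical
  let v : (∀ i, α i) → {S : BoxFace α // S.1.card ≤ k} :=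
    fun s => ⟨vertex s, (card_vertex s).trans_le hk⟩
  let A : (∀ i, α i) → Finset (∀ i, α i) := fun s =>
    Finset.univ.filter fun t => vertex t ≤ ψ (v s)
  have hA : (A s).card = 1 := by
    refine Finset.card_eq_one_of_pairwiseDisjoint (I := Finset.univ) (T := Finset.univ) ?_
      (fun _ _ => Finset.subset_univ _) ?_ le_rfl (Finset.mem_univ s)
    · intro s _
      obtain ⟨t, ht⟩ := exists_vertex_le (ψ (v s))
      exact ⟨t, by simpa [A] using ht⟩
    · intro s _ s' _ hss'
      rw [Function.onFun, Finset.disjoint_left]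
      intro t h1 h2
      simp only [A, Finset.mem_filter, Finset.mem_univ, true_and] at h1 h2
      obtain ⟨U, hU1, hU2, -⟩ := hmeet _ _ _ h1 h2
      obtain ⟨u, hu⟩ := exists_vertex_le U.1
      exact hss' ((vertex_le_vertex (hu.trans hU1)).symm.trans (vertex_le_vertex (hu.trans hU2)))
  obtain ⟨t, ht⟩ := Finset.card_eq_one.1 hA
  have hmem : ∀ t', vertex t' ≤ ψ (v s) ↔ t' = t := fun t' => by
    have : t' ∈ A s ↔ t' = t := by rw [ht, Finset.mem_singleton]
    simpa [A] using this
  have : ψ (v s) = vertex t := by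
    refine eq_vertex_of_le_vertex fun p hp => ?_
    have h1 := (hmem _).1 (vertex_update_le ((hmem t).2 rfl) hp)
    rw [mem_vertex, ← h1, Function.update_self]
  exact (congrArg (fun S : BoxFace α => S.1.card) this).trans (card_vertex t)

lemma card_image {k : ℕ} {ψ : {S : BoxFace α // S.1.card ≤ k} → BoxFace α}
    (hle : ∀ S T, ψ S ≤ ψ T ↔ S ≤ T)
    (hmeet : ∀ S T B, B ≤ ψ S → B ≤ ψ T → ∃ U, U ≤ S ∧ U ≤ T ∧ B ≤ ψ U)
    (m : ℕ) (S : {S : BoxFace α // S.1.card ≤ k}) (hm : S.1.1.card = m) :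
    (ψ S).1.card = S.1.1.card := by
  classical
  induction m generalizing S with
  | zero =>
    have hk : Fintype.card ι ≤ k := (card_le S.1).trans S.2
    obtain ⟨s, hs⟩ := exists_vertex_le S.1
    have : S.1 = vertex s := Subtype.ext (by
      have h1 := Finset.card_le_card hs
      exact (Finset.eq_of_subset_of_card_le hs (by omega)).symm)
    obtain rfl : S = ⟨vertex s, (card_vertex s).trans_le hk⟩ := Subtype.ext this
    rw [card_image_vertex hmeet hk, card_vertex]
  | succ m ih =>
    have hk : Fintype.card ι ≤ k := (card_le S.1).trans S.2
    obtain ⟨s, hs⟩ := exists_vertex_le S.1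
    by_cases hSs : S.1.1 ⊆ (vertex s).1
    · obtain rfl : S = ⟨vertex s, (card_vertex s).trans_le hk⟩ :=
        Subtype.ext (eq_vertex_of_le_vertex hSs)
      rw [card_image_vertex hmeet hk, card_vertex]
    · obtain ⟨p, hpS, hps⟩ := Finset.not_subset.1 hSs
      have hcard0 : (S.1.1.erase p).card = m := by
        rw [Finset.card_erase_of_mem hpS, hm]; rfl
      let S₀ : {S : BoxFace α // S.1.card ≤ k} := ⟨⟨S.1.1.erase p, fun i => ⟨s i,
        Finset.mem_erase.2 ⟨fun h => hps (h ▸ mem_vertex.2 rfl), vertex_le_iff.1 hs i⟩⟩⟩, by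
          have := S.2
          change (S.1.1.erase p).card ≤ k
          omega⟩
      have hS₀ : (ψ S₀).1.card = m := (ih S₀ hcard0).trans hcard0
      let I : Finset (Σ i, α i) := Finset.univ \ S₀.1.1
      have hins : ∀ q ∈ I, (insert q S₀.1).1.card = m + 1 := fun q hq => by
        have hq : q ∉ S₀.1.1 := (Finset.mem_sdiff.1 hq).2
        exact (Finset.card_insert_of_notMem hq).trans (congrArg (· + 1) hcard0)
      have hmk : m + 1 ≤ k := hm ▸ S.2
      let A : (Σ i, α i) → Finset (Σ i, α i) := fun q =>
        if hq : q ∈ I then (ψ ⟨insert q S₀.1, (hins q hq).trans_le hmk⟩).1 \ (ψ S₀).1 else ∅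
      have hpI : p ∈ I := by simp [I, S₀]
      have hlt : ∀ q (hq : q ∈ I), ψ S₀ ≤ ψ ⟨insert q S₀.1, (hins q hq).trans_le hmk⟩ :=
        fun q hq => (hle _ _).2 (Finset.subset_insert _ _)
      have hA : (A p).card = 1 := by
        refine Finset.card_eq_one_of_pairwiseDisjoint (I := I) (T := Finset.univ \ (ψ S₀).1)
          ?_ ?_ ?_ ?_ hpI
        · intro q hq
          simp only [A, hq, dif_pos]
          rw [Finset.sdiff_nonempty]
          intro h
          have h1 := (hle _ _).1 h
          exact (Finset.mem_sdiff.1 hq).2 (h1 (Finset.mem_insert_self _ _))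
        · intro q hq
          simp only [A, hq, dif_pos]
          exact Finset.sdiff_subset_sdiff (Finset.subset_univ _) le_rfl
        · intro q hq q' hq' hqq'
          rw [Finset.mem_coe] at hq hq'
          rw [Function.onFun, Finset.disjoint_left]
          intro x hx hx'
          simp only [A, hq, hq', dif_pos, Finset.mem_sdiff] at hx hx'
          obtain ⟨U, hU1, hU2, hU⟩ := hmeet _ _ (insert x (ψ S₀))
            (Finset.insert_subset hx.1 (hlt q hq)) (Finset.insert_subset hx'.1 (hlt q' hq'))
          have hU0 : U ≤ S₀ := by
            intro y hy
            rcases Finset.mem_insert.1 (hU1 hy) with rfl | h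
            · rcases Finset.mem_insert.1 (hU2 hy) with rfl | h
              · exact absurd rfl hqq'
              · exact h
            · exact h
          exact hx.2 ((hle _ _).2 hU0 (hU (Finset.mem_insert_self _ _)))
        · rw [Finset.card_sdiff_of_subset (Finset.subset_univ _),
            Finset.card_sdiff_of_subset (Finset.subset_univ _), hS₀]
          exact (congrArg (Finset.univ.card - ·) hcard0).ge
      have hSp : S = ⟨insert p S₀.1, (hins p hpI).trans_le hmk⟩ :=
        Subtype.ext (Subtype.ext (Finset.insert_erase hpS).symm)
      simp only [A, hpI, dif_pos] at hA
      rw [← hSp] at hA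
      have hsub : (ψ S₀).1 ⊆ (ψ S).1 := by rw [hSp]; exact hlt p hpI
      rw [Finset.card_sdiff_of_subset hsub, hS₀] at hA
      have := Finset.card_le_card hsub
      omega

/-- A meet-preserving order embedding of a skeleton of a product of simplices into the face poset
has the skeleton as its image. -/
lemma exists_eq_of_orderEmbedding {k : ℕ} {ψ : {S : BoxFace α // S.1.card ≤ k} → BoxFace α}
    (hle : ∀ S T, ψ S ≤ ψ T ↔ S ≤ T)
    (hmeet : ∀ S T B, B ≤ ψ S → B ≤ ψ T → ∃ U, U ≤ S ∧ U ≤ T ∧ B ≤ ψ U)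
    (B : BoxFace α) (hB : B.1.card ≤ k) : ∃ S, ψ S = B := by
  classical
  let φ : {S : BoxFace α // S.1.card ≤ k} → {S : BoxFace α // S.1.card ≤ k} :=
    fun S => ⟨ψ S, (card_image hle hmeet _ S rfl).trans_le S.2⟩
  have hφ : Function.Injective φ := fun S T h => by
    have h' : ψ S = ψ T := congrArg Subtype.val h
    exact le_antisymm ((hle _ _).1 h'.le) ((hle _ _).1 h'.ge)
  obtain ⟨S, hS⟩ := Finite.surjective_of_injective hφ ⟨B, hB⟩
  exact ⟨S, congrArg Subtype.val hS⟩

end BoxFace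

end BoxFace

section ProdSimplexFaces

open BoxFace

variable {r : ℕ} (n : Fin r → ℕ)

/-- The face of a product of standard simplices spanned by a set of vertices of the factors. -/
def simplexFace (S : BoxFace fun i => Fin (n i + 1)) : Set ((i : Fin r) → Fin (n i + 1) → ℝ) :=
  {x ∈ prodSimplex n | ∀ i a, ⟨i, a⟩ ∉ S.1 → x i a = 0}

/-- A vertex of a product of standard simplices. -/
def simplexVertex (s : (i : Fin r) → Fin (n i + 1)) : (i : Fin r) → Fin (n i + 1) → ℝ :=
  fun i => Pi.single (s i) 1

variable {n}

lemma mem_prodSimplex {x : (i : Fin r) → Fin (n i + 1) → ℝ} :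
    x ∈ prodSimplex n ↔ ∀ i, (∀ a, 0 ≤ x i a) ∧ ∑ a, x i a = 1 := by
  simp [prodSimplex, stdSimplex, Set.mem_pi]

lemma simplexVertex_apply (s : (i : Fin r) → Fin (n i + 1)) (i : Fin r) (a : Fin (n i + 1)) :
    simplexVertex n s i a = if a = s i then 1 else 0 := by
  simp [simplexVertex, Pi.single_apply]

lemma simplexVertex_mem (s : (i : Fin r) → Fin (n i + 1)) : simplexVertex n s ∈ prodSimplex n := by
  refine mem_prodSimplex.2 fun i => ⟨fun a => ?_, ?_⟩
  · rw [simplexVertex_apply]; split_ifs <;> norm_num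
  · simp [simplexVertex_apply]

lemma simplexVertex_mem_simplexFace {s : (i : Fin r) → Fin (n i + 1)}
    {S : BoxFace fun i => Fin (n i + 1)} (h : vertex s ≤ S) :
    simplexVertex n s ∈ simplexFace n S := by
  refine ⟨simplexVertex_mem s, fun i a ha => ?_⟩
  rw [simplexVertex_apply, if_neg]
  rintro rfl
  exact ha (vertex_le_iff.1 h i)

lemma simplexFace_subset_iff {S T : BoxFace fun i => Fin (n i + 1)} :
    simplexFace n S ⊆ simplexFace n T ↔ S ≤ T := by
  constructor
  · rintro h p hp
    obtain ⟨s, hs, hsp⟩ := exists_vertex_le_of_mem hp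
    by_contra hpT
    have := (h (simplexVertex_mem_simplexFace hs)).2 p.1 p.2 hpT
    rw [simplexVertex_apply, if_pos hsp.symm] at this
    exact one_ne_zero this
  · exact fun h x hx => ⟨hx.1, fun i a ha => hx.2 i a fun h' => ha (h h')⟩

/-- The set of maximizers of a linear functional on a product of simplices. -/
lemma setOf_maximal_eq_simplexFace (c : ((i : Fin r) → Fin (n i + 1) → ℝ) →ₗ[ℝ] ℝ)
    (C : (i : Fin r) → Fin (n i + 1) → ℝ) (hC : ∀ x, c x = ∑ i, ∑ a, x i a * C i a)
    (S : BoxFace fun i => Fin (n i + 1))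
    (hS : ∀ i a, (⟨i, a⟩ : Σ i, Fin (n i + 1)) ∈ S.1 ↔ ∀ b, C i b ≤ C i a) :
    {x ∈ prodSimplex n | ∀ y ∈ prodSimplex n, c y ≤ c x} = simplexFace n S := by
  obtain ⟨s, hs⟩ := exists_vertex_le S
  have hmax : ∀ i a, C i a ≤ C i (s i) := fun i => (hS i _).1 (vertex_le_iff.1 hs i)
  have hdiff : ∀ x ∈ prodSimplex n,
      (∑ i, C i (s i)) - c x = ∑ i, ∑ a, x i a * (C i (s i) - C i a) := by
    intro x hx
    rw [hC, ← Finset.sum_sub_distrib]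
    refine Finset.sum_congr rfl fun i _ => ?_
    simp only [mul_sub, Finset.sum_sub_distrib, ← Finset.sum_mul]
    rw [(mem_prodSimplex.1 hx i).2, one_mul]
  have hnn : ∀ x ∈ prodSimplex n, ∀ i a, 0 ≤ x i a * (C i (s i) - C i a) := fun x hx i a =>
    mul_nonneg ((mem_prodSimplex.1 hx i).1 a) (sub_nonneg.2 (hmax i a))
  have hle : ∀ x ∈ prodSimplex n, c x ≤ ∑ i, C i (s i) := fun x hx => by
    rw [← sub_nonneg, hdiff x hx]
    exact Finset.sum_nonneg fun i _ => Finset.sum_nonneg fun a _ => hnn x hx i a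
  have hv : c (simplexVertex n s) = ∑ i, C i (s i) := by
    rw [hC]; simp [simplexVertex_apply]
  ext x
  constructor
  · rintro ⟨hx, h⟩
    refine ⟨hx, fun i a ha => ?_⟩
    have h0 : ∑ i, ∑ a, x i a * (C i (s i) - C i a) = 0 := by
      rw [← hdiff x hx, sub_eq_zero]
      exact le_antisymm (hv ▸ h _ (simplexVertex_mem s)) (hle x hx)
    have h1 := (Finset.sum_eq_zero_iff_of_nonneg fun i _ =>
      Finset.sum_nonneg fun a _ => hnn x hx i a).1 h0 i (Finset.mem_univ i)
    have h2 := (Finset.sum_eq_zero_iff_of_nonneg fun a _ => hnn x hx i a).1 h1 a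
      (Finset.mem_univ a)
    rcases mul_eq_zero.1 h2 with h | h
    · exact h
    · rw [hS] at ha
      refine absurd (fun b => ?_) ha
      rw [← sub_eq_zero.1 h]
      exact hmax i b
  · rintro ⟨hx, h⟩
    refine ⟨hx, fun y hy => (hle y hy).trans (le_of_eq ?_)⟩
    rw [← sub_eq_zero, hdiff x hx]
    refine Finset.sum_eq_zero fun i _ => Finset.sum_eq_zero fun a _ => ?_
    by_cases ha : (⟨i, a⟩ : Σ i, Fin (n i + 1)) ∈ S.1
    · rw [le_antisymm ((hS i a).1 ha (s i)) (hmax i a), sub_self, mul_zero]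
    · rw [h i a ha, zero_mul]

lemma isFace_simplexFace (S : BoxFace fun i => Fin (n i + 1)) :
    IsFace (prodSimplex n) (simplexFace n S) := by
  obtain ⟨s, hs⟩ := exists_vertex_le S
  refine ⟨⟨_, simplexVertex_mem_simplexFace hs⟩, ?_⟩
  let C : (i : Fin r) → Fin (n i + 1) → ℝ := fun i a => if ⟨i, a⟩ ∈ S.1 then 1 else 0
  refine ⟨∑ i, ∑ a, C i a •
      ((LinearMap.proj (R := ℝ) (φ := fun _ : Fin (n i + 1) => ℝ) a) ∘ₗ
        LinearMap.proj (R := ℝ) (φ := fun i => Fin (n i + 1) → ℝ) i),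
    (setOf_maximal_eq_simplexFace _ C (fun x => ?_) S fun i a => ?_).symm⟩
  · simp [LinearMap.sum_apply, mul_comm]
  · simp only [C]
    constructor
    · intro h b
      rw [if_pos h]
      split_ifs <;> norm_num
    · intro h
      by_contra h'
      have := h (s i)
      rw [if_neg h', if_pos (vertex_le_iff.1 hs i)] at this
      norm_num at this

lemma exists_simplexFace_eq {F : Set ((i : Fin r) → Fin (n i + 1) → ℝ)}
    (hF : IsFace (prodSimplex n) F) : ∃ S, simplexFace n S = F := by
  classical
  obtain ⟨-, c, rfl⟩ := hF
  let C : (i : Fin r) → Fin (n i + 1) → ℝ := fun i a => c (Pi.single i (Pi.single a 1))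
  let S : BoxFace fun i => Fin (n i + 1) :=
    ⟨Finset.univ.filter fun p => ∀ b, C p.1 b ≤ C p.1 p.2, fun i => by
      obtain ⟨a, ha⟩ := Finite.exists_max (C i)
      exact ⟨a, by simpa using ha⟩⟩
  refine ⟨S, (setOf_maximal_eq_simplexFace c C (fun x => ?_) S fun i a => by simp [S]).symm⟩
  have : x = ∑ i, ∑ a, x i a • (Pi.single i (Pi.single a 1) :
      (i : Fin r) → Fin (n i + 1) → ℝ) := by
    funext j b
    rw [Finset.sum_apply, Finset.sum_apply, Finset.sum_eq_single j, Finset.sum_apply,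
      Finset.sum_apply, Finset.sum_eq_single b]
    · simp
    · intro a _ ha
      simp [ha.symm]
    · simp
    · intro i _ hi
      rw [Finset.sum_apply]
      simp [hi.symm]
    · simp
  conv_lhs => rw [this]
  simp [C]

variable (n) in
/-- The face poset of a product of simplices. -/
noncomputable def boxFaceOrderIso :
    (BoxFace fun i => Fin (n i + 1)) ≃o facesOf (prodSimplex n) :=
  RelIso.ofSurjective
    (OrderEmbedding.ofMapLEIff
      (fun S => (⟨simplexFace n S, isFace_simplexFace S⟩ : facesOf (prodSimplex n)))
      fun _ _ => simplexFace_subset_iff)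
    fun F => (exists_simplexFace_eq F.2).imp fun _ h => Subtype.ext h

lemma linearIndependent_of_dual {M κ : Type*} [AddCommGroup M] [Module ℝ M] (v : κ → M)
    (f : κ → M →ₗ[ℝ] ℝ) (h1 : Pairwise fun i j => f i (v j) = 0) (h2 : ∀ i, f i (v i) ≠ 0) :
    LinearIndependent ℝ v := by
  refine LinearIndependent.of_pairwise_dual_eq_zero_one v (fun i => (f i (v i))⁻¹ • f i) ?_ ?_
  · intro i j hij
    simp [h1 hij]
  · intro i
    simp [h2 i]

lemma polyDim_simplexFace (S : BoxFace fun i => Fin (n i + 1)) :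
    polyDim (simplexFace n S) + r = S.1.card := by
  classical
  obtain ⟨s, hs⟩ := exists_vertex_le S
  let u : (Σ i, Fin (n i + 1)) → (i : Fin r) → Fin (n i + 1) → ℝ := fun p =>
    simplexVertex n (Function.update s p.1 p.2) - simplexVertex n s
  let I := S.1 \ (vertex s).1
  have hu : ∀ p q : Σ i, Fin (n i + 1), q.2 ≠ s q.1 → u p q.1 q.2 = if q = p then 1 else 0 := by
    rintro ⟨i, a⟩ ⟨j, b⟩ hb
    simp only at hb
    simp only [u, Pi.sub_apply, simplexVertex_apply, if_neg hb, sub_zero]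
    rcases eq_or_ne j i with rfl | hij
    · simp
    · simp [hij, hb]
  have hli : LinearIndependent ℝ fun p : I => u p := by
    refine linearIndependent_of_dual _
      (fun q => LinearMap.proj (q : Σ i, Fin (n i + 1)).2 ∘ₗ
        LinearMap.proj (q : Σ i, Fin (n i + 1)).1) ?_ ?_
    · intro q p hqp
      have hq : (q : Σ i, Fin (n i + 1)).2 ≠ s q.1.1 := fun h =>
        (Finset.mem_sdiff.1 q.2).2 (mem_vertex.2 h)
      have := hu p q hq
      rw [if_neg fun h => hqp (Subtype.ext h)] at this
      exact this
    · intro q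
      have hq : (q : Σ i, Fin (n i + 1)).2 ≠ s q.1.1 := fun h =>
        (Finset.mem_sdiff.1 q.2).2 (mem_vertex.2 h)
      have := hu q q hq
      rw [if_pos rfl] at this
      exact ne_of_eq_of_ne this one_ne_zero
  have hspan : (affineSpan ℝ (simplexFace n S)).direction =
      Submodule.span ℝ (Set.range fun p : I => u p) := by
    rw [direction_affineSpan]
    apply le_antisymm
    · rw [vectorSpan_eq_span_vsub_set_right ℝ (simplexVertex_mem_simplexFace hs), Submodule.span_le]
      rintro _ ⟨x, hx, rfl⟩
      have hx1 := mem_prodSimplex.1 hx.1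
      have : x -ᵥ simplexVertex n s = ∑ p ∈ I, x p.1 p.2 • u p := by
        have hoff : ∀ q : Σ i, Fin (n i + 1), q.2 ≠ s q.1 →
            (x -ᵥ simplexVertex n s) q.1 q.2 = (∑ p ∈ I, x p.1 p.2 • u p) q.1 q.2 := by
          intro q hq
          simp only [vsub_eq_sub, Pi.sub_apply, simplexVertex_apply, if_neg hq, sub_zero,
            Finset.sum_apply, Pi.smul_apply, hu _ q hq, smul_eq_mul, mul_ite, mul_one, mul_zero]
          rw [Finset.sum_ite_eq]
          split_ifs with h
          · rfl
          · refine hx.2 _ _ fun h' => h (Finset.mem_sdiff.2 ⟨h', fun h'' => hq (mem_vertex.1 h'')⟩)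
        have hsumu : ∀ p i, ∑ a, u p i a = 0 := fun p i => by
          simp only [u, Pi.sub_apply, Finset.sum_sub_distrib]
          rw [(mem_prodSimplex.1 (simplexVertex_mem _) i).2,
            (mem_prodSimplex.1 (simplexVertex_mem _) i).2, sub_self]
        have hsum : ∀ i, ∑ a, (x -ᵥ simplexVertex n s) i a =
            ∑ a, (∑ p ∈ I, x p.1 p.2 • u p) i a := by
          intro i
          simp only [vsub_eq_sub, Pi.sub_apply, Finset.sum_sub_distrib, Finset.sum_apply,
            Pi.smul_apply]
          rw [Finset.sum_comm, (hx1 i).2, (mem_prodSimplex.1 (simplexVertex_mem s) i).2]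
          simp only [smul_eq_mul, ← Finset.mul_sum, hsumu, mul_zero, Finset.sum_const_zero,
            sub_self]
        funext i a
        by_cases ha : a = s i
        · have h1 := hsum i
          rw [← Finset.add_sum_erase _ _ (Finset.mem_univ (s i)),
            ← Finset.add_sum_erase _ (fun a => (∑ p ∈ I, x p.1 p.2 • u p) i a)
              (Finset.mem_univ (s i)),
            Finset.sum_congr rfl fun b hb => hoff ⟨i, b⟩ (Finset.ne_of_mem_erase hb)] at h1
          rw [ha]
          exact add_right_cancel h1
        · exact hoff ⟨i, a⟩ ha
      change x -ᵥ simplexVertex n s ∈ Submodule.span ℝ _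
      rw [this]
      exact Submodule.sum_mem _ fun p hp =>
        Submodule.smul_mem _ _ (Submodule.subset_span ⟨⟨p, hp⟩, rfl⟩)
    · rw [Submodule.span_le]
      rintro _ ⟨p, rfl⟩
      exact vsub_mem_vectorSpan ℝ
        (simplexVertex_mem_simplexFace (vertex_update_le hs (Finset.mem_sdiff.1 p.2).1))
        (simplexVertex_mem_simplexFace hs)
  have hcard : I.card = S.1.card - r := by
    rw [Finset.card_sdiff_of_subset hs, card_vertex, Fintype.card_fin]
  have hr := card_le S
  rw [Fintype.card_fin] at hr
  rw [polyDim, hspan, finrank_span_eq_card hli, Fintype.card_coe, hcard]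
  omega

end ProdSimplexFaces

section FaceLabelling

open BoxFace

variable {M : Type*} [AddCommGroup M] [Module ℝ M]

/-- The set of maximizers of a linear functional on a set. -/
def maxFace (P : Set M) (c : M →ₗ[ℝ] ℝ) : Set M := {x ∈ P | ∀ y ∈ P, c y ≤ c x}

lemma IsPolytope.maxFace_nonempty {P : Set M} (hP : IsPolytope P) (hne : P.Nonempty)
    (c : M →ₗ[ℝ] ℝ) : (maxFace P c).Nonempty := by
  obtain ⟨V, rfl⟩ := hP
  have hV : V.Nonempty := by
    rw [convexHull_nonempty_iff] at hne
    exact_mod_cast hne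
  obtain ⟨v, hv, hmax⟩ := V.exists_max_image c hV
  refine ⟨v, subset_convexHull ℝ _ hv, fun y hy => ?_⟩
  have : convexHull ℝ (V : Set M) ⊆ {y | c y ≤ c v} :=
    convexHull_min (fun w hw => hmax w hw) (convex_halfSpace_le c.isLinear _)
  exact this hy

lemma maxFace_add {P : Set M} {c d : M →ₗ[ℝ] ℝ} (h : (maxFace P c ∩ maxFace P d).Nonempty) :
    maxFace P (c + d) = maxFace P c ∩ maxFace P d := by
  obtain ⟨z, hc, hd⟩ := h
  ext x
  constructor
  · rintro ⟨hx, h⟩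
    have h1 := h z hc.1
    have h2 := hc.2 x hx
    have h3 := hd.2 x hx
    simp only [LinearMap.add_apply] at h1
    exact ⟨⟨hx, fun y hy => (hc.2 y hy).trans (by linarith)⟩,
      ⟨hx, fun y hy => (hd.2 y hy).trans (by linarith)⟩⟩
  · rintro ⟨h1, h2⟩
    exact ⟨h1.1, fun y hy => add_le_add (h1.2 y hy) (h2.2 y hy)⟩

lemma IsFace.inter {P F G : Set M} (hF : IsFace P F) (hG : IsFace P G) (h : (F ∩ G).Nonempty) :
    IsFace P (F ∩ G) := by
  obtain ⟨-, c, rfl⟩ := hF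
  obtain ⟨-, d, rfl⟩ := hG
  exact ⟨h, c + d, (maxFace_add h).symm⟩

variable {ι : Type*} {α : ι → Type*} [Fintype ι] [DecidableEq ι] [∀ i, DecidableEq (α i)]

/-- A labelling of the faces of `Q` by the faces of a product of simplices, together with a point
in every face labelled by a vertex. -/
structure FaceLabelling (Q : Set M) (α : ι → Type*) [∀ i, DecidableEq (α i)] where
  /-- A point of the face labelled by a vertex. -/
  point : (∀ i, α i) → M
  /-- The label of the face exposed by a functional. -/
  label : (M →ₗ[ℝ] ℝ) → BoxFace α
  point_mem : ∀ s, point s ∈ Q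
  point_mem_maxFace_iff : ∀ c s, point s ∈ maxFace Q c ↔ vertex s ≤ label c
  exists_label_eq : ∀ A, ∃ c, label c = A

/-- The face of `P` exposed by a linear functional that attains its maximum on `P`. -/
def exposedFace {P : Set M} (hP : ∀ c : M →ₗ[ℝ] ℝ, (maxFace P c).Nonempty) (c : M →ₗ[ℝ] ℝ) :
    facesOf P :=
  ⟨maxFace P c, hP c, c, rfl⟩

lemma exists_exposedFace_eq {P : Set M} (hP : ∀ c : M →ₗ[ℝ] ℝ, (maxFace P c).Nonempty)
    (F : facesOf P) : ∃ c, exposedFace hP c = F := by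
  obtain ⟨-, -, c, rfl⟩ := F
  exact ⟨c, rfl⟩

/-- An isomorphism of face lattices yields a labelling. -/
noncomputable def FaceLabelling.ofOrderIso {Q : Set M}
    (hQ : ∀ c : M →ₗ[ℝ] ℝ, (maxFace Q c).Nonempty) (Φ : facesOf Q ≃o BoxFace α) :
    FaceLabelling Q α where
  point s := (Φ.symm (vertex s)).2.1.some
  label c := Φ (exposedFace hQ c)
  point_mem s := by
    obtain ⟨c, hc⟩ := (Φ.symm (vertex s)).2.2
    have h := (Φ.symm (vertex s)).2.1.some_mem
    exact (hc.subset h).1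
  point_mem_maxFace_iff c s := by
    have hmem := (Φ.symm (vertex s)).2.1.some_mem
    constructor
    · intro h
      let U : facesOf Q := ⟨_, (Φ.symm (vertex s)).2.inter (exposedFace hQ c).2 ⟨_, hmem, h⟩⟩
      have h1 : U ≤ Φ.symm (vertex s) := fun x hx => hx.1
      have h2 : U ≤ exposedFace hQ c := fun x hx => hx.2
      rw [← eq_vertex_of_le_vertex ((Φ.le_symm_apply).1 h1)]
      exact Φ.monotone h2
    · intro h
      exact ((Φ.symm_apply_le).2 h : Φ.symm (vertex s) ≤ exposedFace hQ c) hmem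
  exists_label_eq A := by
    obtain ⟨c, hc⟩ := exists_exposedFace_eq hQ (Φ.symm A)
    exact ⟨c, by rw [hc, Φ.apply_symm_apply]⟩

namespace FaceLabelling

variable {Q : Set M} (L : FaceLabelling Q α)

lemma apply_le {c : M →ₗ[ℝ] ℝ} {s : ∀ i, α i} (hs : vertex s ≤ L.label c) {y : M} (hy : y ∈ Q) :
    c y ≤ c (L.point s) :=
  ((L.point_mem_maxFace_iff c s).2 hs).2 y hy

lemma apply_eq {c : M →ₗ[ℝ] ℝ} {s t : ∀ i, α i} (hs : vertex s ≤ L.label c)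
    (ht : vertex t ≤ L.label c) : c (L.point t) = c (L.point s) :=
  le_antisymm (L.apply_le hs (L.point_mem t)) (L.apply_le ht (L.point_mem s))

lemma vertex_le_label {c : M →ₗ[ℝ] ℝ} {s : ∀ i, α i}
    (h : ∀ t, c (L.point t) ≤ c (L.point s)) : vertex s ≤ L.label c := by
  obtain ⟨t, ht⟩ := exists_vertex_le (L.label c)
  exact (L.point_mem_maxFace_iff c s).1
    ⟨L.point_mem s, fun y hy => (L.apply_le ht hy).trans (by
      by_contra! hlt
      exact absurd (h t) (not_le.2 hlt))⟩

lemma apply_lt {c : M →ₗ[ℝ] ℝ} {s t : ∀ i, α i} (hs : vertex s ≤ L.label c)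
    (ht : ¬ vertex t ≤ L.label c) : c (L.point t) < c (L.point s) := by
  refine lt_of_le_of_ne (L.apply_le hs (L.point_mem t)) fun h => ht (L.vertex_le_label fun u => ?_)
  rw [h]
  exact L.apply_le hs (L.point_mem u)

section Facets

variable {L}

lemma vertex_le_label_facet {ℓ : (Σ i, α i) → M →ₗ[ℝ] ℝ}
    (hℓ : ∀ p q, q ∈ (L.label (ℓ p)).1 ↔ q ≠ p) {s : ∀ i, α i} {p : Σ i, α i} :
    vertex s ≤ L.label (ℓ p) ↔ p.2 ≠ s p.1 := by
  rw [vertex_le_iff]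
  simp only [hℓ]
  constructor
  · intro h h'
    apply h p.1
    rw [← h']
  · rintro h i rfl
    exact h rfl

lemma facet_apply_edge {ℓ : (Σ i, α i) → M →ₗ[ℝ] ℝ}
    (hℓ : ∀ p q, q ∈ (L.label (ℓ p)).1 ↔ q ≠ p) {s : ∀ i, α i} {p q : Σ i, α i}
    (hp : p.2 ≠ s p.1) (hpq : p ≠ q) :
    ℓ p (L.point (Function.update s q.1 q.2) - L.point s) = 0 := by
  rw [map_sub, sub_eq_zero]
  refine L.apply_eq ((vertex_le_label_facet hℓ).2 hp) ?_
  exact vertex_update_le ((vertex_le_label_facet hℓ).2 hp) ((hℓ p q).2 hpq.symm)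

lemma facet_apply_edge_self {ℓ : (Σ i, α i) → M →ₗ[ℝ] ℝ}
    (hℓ : ∀ p q, q ∈ (L.label (ℓ p)).1 ↔ q ≠ p) {s : ∀ i, α i} {p : Σ i, α i}
    (hp : p.2 ≠ s p.1) :
    ℓ p (L.point (Function.update s p.1 p.2) - L.point s) < 0 := by
  rw [map_sub, sub_neg]
  exact L.apply_lt ((vertex_le_label_facet hℓ).2 hp) fun h =>
    (vertex_le_label_facet hℓ).1 h (by simp)

end Facets

variable [∀ i, Fintype (α i)]

/-- A vertex at which a linear functional is maximal among the neighbouring vertices is a global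
maximum. -/
lemma apply_le_of_forall_update (c : M →ₗ[ℝ] ℝ) (s : ∀ i, α i)
    (h : ∀ p : Σ i, α i, c (L.point (Function.update s p.1 p.2)) ≤ c (L.point s)) (t : ∀ i, α i) :
    c (L.point t) ≤ c (L.point s) := by
  classical
  by_contra! hlt
  obtain ⟨g, hg⟩ := L.exists_label_eq (vertex s)
  have hgs : vertex s ≤ L.label g := hg.ge
  have hgt : ∀ t, t ≠ s → g (L.point t) < g (L.point s) := fun t ht =>
    L.apply_lt hgs fun h => ht (vertex_le_vertex (h.trans hg.le))
  let T := Finset.univ.filter fun t => c (L.point s) < c (L.point t)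
  let q : (∀ i, α i) → ℝ := fun t =>
    (g (L.point s) - g (L.point t)) / (c (L.point t) - c (L.point s))
  obtain ⟨u, hu, hmin⟩ := T.exists_min_image q ⟨t, by simpa [T] using hlt⟩
  have hcu : c (L.point s) < c (L.point u) := by simpa [T] using hu
  have hus : u ≠ s := by rintro rfl; exact lt_irrefl _ hcu
  have hq : 0 < q u := div_pos (sub_pos.2 (hgt u hus)) (sub_pos.2 hcu)
  have hqu : q u * (c (L.point u) - c (L.point s)) = g (L.point s) - g (L.point u) :=
    div_mul_cancel₀ _ (sub_pos.2 hcu).ne'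
  let d := g + q u • c
  have hd : ∀ x, d x = g x + q u * c x := fun x => rfl
  have hds : vertex s ≤ L.label d := by
    refine L.vertex_le_label fun t => ?_
    rw [hd, hd]
    rcases lt_or_ge (c (L.point s)) (c (L.point t)) with h1 | h1
    · have h2 : q u ≤ q t := hmin t (by simpa [T] using h1)
      have h3 : q u * (c (L.point t) - c (L.point s)) ≤ g (L.point s) - g (L.point t) :=
        (le_div_iff₀ (sub_pos.2 h1)).1 h2
      linarith
    · have h2 := mul_le_mul_of_nonneg_left h1 hq.le
      have h3 := L.apply_le hgs (L.point_mem t)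
      linarith
  have hdu : vertex u ≤ L.label d := by
    refine L.vertex_le_label fun t => ?_
    refine (L.apply_le hds (L.point_mem t)).trans (le_of_eq ?_)
    rw [hd, hd]
    linarith
  obtain ⟨i, hi⟩ := Function.ne_iff.1 hus
  have hupd := L.apply_eq hds (vertex_update_le hds (vertex_le_iff.1 hdu i))
  have h1 := hgt (Function.update s i (u i)) fun h' => hi (by
    rw [← congrFun h' i, Function.update_self])
  have h2 := mul_le_mul_of_nonneg_left (h ⟨i, u i⟩) hq.le
  rw [hd, hd] at hupd
  simp only at h2 hupd
  linarith

/-- A linear functional that is constant along the edges at a vertex is constant. -/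
lemma apply_eq_zero_of_forall_update {c : M →ₗ[ℝ] ℝ} {s : ∀ i, α i}
    (h : ∀ p : Σ i, α i, c (L.point (Function.update s p.1 p.2)) = c (L.point s)) {w : M}
    (hw : w ∈ vectorSpan ℝ Q) : c w = 0 := by
  have key : ∀ c : M →ₗ[ℝ] ℝ, (∀ p : Σ i, α i,
      c (L.point (Function.update s p.1 p.2)) = c (L.point s)) → ∀ y ∈ Q, c y ≤ c (L.point s) :=
    fun c h y hy => L.apply_le (L.vertex_le_label (L.apply_le_of_forall_update c s fun p =>
      (h p).le)) hy
  have hconst : ∀ y ∈ Q, c y = c (L.point s) := fun y hy =>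
    le_antisymm (key c h y hy) (by simpa using key (-c) (fun p => by simp [h p]) y hy)
  have : vectorSpan ℝ Q ≤ LinearMap.ker c := by
    rw [vectorSpan, Submodule.span_le]
    rintro _ ⟨x, hx, y, hy, rfl⟩
    simp [hconst x hx, hconst y hy]
  exact this hw

/-- A functional exposing the facet opposite to one vertex of one factor. -/
lemma exists_facet [∀ i, Nontrivial (α i)] :
    ∃ ℓ : (Σ i, α i) → M →ₗ[ℝ] ℝ, ∀ p q, q ∈ (L.label (ℓ p)).1 ↔ q ≠ p := by
  have : ∀ p : Σ i, α i, ∃ ℓ : M →ₗ[ℝ] ℝ, ∀ q, q ∈ (L.label ℓ).1 ↔ q ≠ p := by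
    rintro ⟨i, a⟩
    let A : BoxFace α := ⟨Finset.univ.erase ⟨i, a⟩, fun j => by
      rcases eq_or_ne j i with rfl | hij
      · obtain ⟨b, hb⟩ := exists_ne a
        exact ⟨b, by simpa using hb⟩
      · obtain ⟨b⟩ : Nonempty (α j) := inferInstance
        exact ⟨b, by simp [hij]⟩⟩
    obtain ⟨ℓ, hℓ⟩ := L.exists_label_eq A
    exact ⟨ℓ, fun q => by simp [hℓ, A]⟩
  choose ℓ hℓ using this
  exact ⟨ℓ, hℓ⟩

variable {L}

lemma card_le_finrank_add [Module.Finite ℝ M] [∀ i, Nontrivial (α i)] (L : FaceLabelling Q α) :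
    Fintype.card (Σ i, α i) ≤ Module.finrank ℝ (vectorSpan ℝ Q) + Fintype.card ι := by
  classical
  obtain ⟨ℓ, hℓ⟩ := L.exists_facet
  have s : ∀ i, α i := fun i => (exists_pair_ne (α i)).choose
  let I : Finset (Σ i, α i) := Finset.univ \ (vertex s).1
  have hI : ∀ p : I, (p : Σ i, α i).2 ≠ s p.1.1 := fun p h =>
    (Finset.mem_sdiff.1 p.2).2 (mem_vertex.2 h)
  let u : I → vectorSpan ℝ Q := fun p =>
    ⟨L.point (Function.update s p.1.1 p.1.2) - L.point s,
      vsub_mem_vectorSpan ℝ (L.point_mem _) (L.point_mem _)⟩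
  have hu : LinearIndependent ℝ u := by
    refine linearIndependent_of_dual u (fun p => ℓ p ∘ₗ (vectorSpan ℝ Q).subtype) ?_ ?_
    · intro p q hpq
      exact facet_apply_edge hℓ (hI p) fun h => hpq (Subtype.ext h)
    · intro p
      exact (facet_apply_edge_self hℓ (hI p)).ne
  have h1 := hu.fintype_card_le_finrank
  have h2 : I.card = Fintype.card (Σ i, α i) - Fintype.card ι := by
    rw [Finset.card_sdiff_of_subset (Finset.subset_univ _), card_vertex, Finset.card_univ]
  rw [Fintype.card_coe, h2] at h1
  omega

/-- On the linear space parallel to `Q`, every functional is a nonnegative combination of the facet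
functionals of the facets that contain a vertex of its face. -/
lemma exists_apply_eq_sum {ℓ : (Σ i, α i) → M →ₗ[ℝ] ℝ}
    (hℓ : ∀ p q, q ∈ (L.label (ℓ p)).1 ↔ q ≠ p) (c : M →ₗ[ℝ] ℝ) :
    ∃ μ : (Σ i, α i) → ℝ, (∀ p, p ∈ (L.label c).1 → μ p = 0) ∧
      (∀ p, p ∉ (L.label c).1 → 0 < μ p) ∧
      ∀ w ∈ vectorSpan ℝ Q, c w = ∑ p, μ p * ℓ p w := by
  classical
  obtain ⟨s, hs⟩ := exists_vertex_le (L.label c)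
  let u : (Σ i, α i) → M := fun p => L.point (Function.update s p.1 p.2) - L.point s
  let μ : (Σ i, α i) → ℝ := fun p => c (u p) / ℓ p (u p)
  have hmem : ∀ p, p ∈ (L.label c).1 → μ p = 0 := fun p hp => by
    have : c (u p) = 0 := by
      rw [map_sub, sub_eq_zero]
      exact L.apply_eq hs (vertex_update_le hs hp)
    simp [μ, this]
  have hne : ∀ p, p ∉ (L.label c).1 → p.2 ≠ s p.1 := by
    rintro ⟨i, a⟩ hp (rfl : a = s i)
    exact hp (vertex_le_iff.1 hs i)
  have hnotMem : ∀ p, p ∉ (L.label c).1 → 0 < μ p := fun p hp => by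
    refine div_pos_of_neg_of_neg ?_ (facet_apply_edge_self hℓ (hne p hp))
    rw [map_sub, sub_neg]
    refine L.apply_lt hs fun h => hp ?_
    simpa using vertex_le_iff.1 h p.1
  refine ⟨μ, hmem, hnotMem, fun w hw => ?_⟩
  have key := L.apply_eq_zero_of_forall_update (c := c - ∑ p, μ p • ℓ p) (s := s)
    (fun q => ?_) hw
  · rw [LinearMap.sub_apply, sub_eq_zero] at key
    simpa using key
  · rw [← sub_eq_zero, ← map_sub]
    change (c - ∑ p, μ p • ℓ p) (u q) = 0
    rw [LinearMap.sub_apply, LinearMap.sum_apply, Finset.sum_eq_single q]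
    · rw [LinearMap.smul_apply, smul_eq_mul, sub_eq_zero]
      by_cases hq : q.2 = s q.1
      · have : u q = 0 := by
          simp only [u, hq, Function.update_eq_self, sub_self]
        simp [this]
      · exact (div_mul_cancel₀ _ (facet_apply_edge_self hℓ hq).ne).symm
    · intro p _ hpq
      rw [LinearMap.smul_apply, smul_eq_mul]
      by_cases hp : p ∈ (L.label c).1
      · rw [hmem p hp, zero_mul]
      · rw [facet_apply_edge hℓ (hne p hp) hpq, mul_zero]
    · simp

lemma eq_zero_of_facets {ℓ : (Σ i, α i) → M →ₗ[ℝ] ℝ}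
    (hℓ : ∀ p q, q ∈ (L.label (ℓ p)).1 ↔ q ≠ p) {w : M} (hw : w ∈ vectorSpan ℝ Q)
    (h : ∀ p, ℓ p w = 0) : w = 0 := by
  refine (Module.forall_dual_apply_eq_zero_iff ℝ w).1 fun c => ?_
  obtain ⟨μ, -, -, hμ⟩ := exists_apply_eq_sum hℓ c
  rw [hμ w hw]
  exact Finset.sum_eq_zero fun p _ => by rw [h p, mul_zero]

lemma facet_apply_eq_zero {ℓ : (Σ i, α i) → M →ₗ[ℝ] ℝ}
    (hℓ : ∀ p q, q ∈ (L.label (ℓ p)).1 ↔ q ≠ p) {c : M →ₗ[ℝ] ℝ} {w : M}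
    (hw : w ∈ vectorSpan ℝ Q) (hc : c w = 0) (h : ∀ p ∉ (L.label c).1, ℓ p w ≤ 0)
    {p : Σ i, α i} (hp : p ∉ (L.label c).1) : ℓ p w = 0 := by
  obtain ⟨μ, h0, hpos, hμ⟩ := exists_apply_eq_sum hℓ c
  rw [hμ w hw, Finset.sum_eq_zero_iff_of_nonpos] at hc
  · exact (mul_eq_zero.1 (hc p (Finset.mem_univ p))).resolve_left (hpos p hp).ne'
  · intro q _
    by_cases hq : q ∈ (L.label c).1
    · rw [h0 q hq, zero_mul]
    · exact mul_nonpos_of_nonneg_of_nonpos (hpos q hq).le (h q hq)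

end FaceLabelling

end FaceLabelling

section Projection

open BoxFace

variable {M M' : Type*} [AddCommGroup M] [Module ℝ M] [AddCommGroup M'] [Module ℝ M']
  {Q : Set M} {f : M →ₗ[ℝ] M'}

lemma inter_preimage_maxFace (g : M' →ₗ[ℝ] ℝ) :
    Q ∩ f ⁻¹' maxFace (f '' Q) g = maxFace Q (g ∘ₗ f) := by
  ext x
  constructor
  · rintro ⟨hx, -, h⟩
    exact ⟨hx, fun y hy => h _ (mem_image_of_mem f hy)⟩
  · rintro ⟨hx, h⟩
    refine ⟨hx, mem_image_of_mem f hx, ?_⟩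
    rintro _ ⟨y, hy, rfl⟩
    exact h y hy

lemma IsFace.subset {P F : Set M} (hF : IsFace P F) : F ⊆ P := by
  obtain ⟨-, c, rfl⟩ := hF
  exact fun x hx => hx.1

/-- The preimage in `Q` of a face of a linear image of `Q`. -/
def pullbackFace (G : facesOf (f '' Q)) : facesOf Q :=
  ⟨Q ∩ f ⁻¹' G, by
    obtain ⟨y, hy⟩ := G.2.1
    obtain ⟨x, hx, rfl⟩ := G.2.subset hy
    refine ⟨⟨x, hx, hy⟩, ?_⟩
    obtain ⟨-, c, hc⟩ := G.2
    exact ⟨c ∘ₗ f, by rw [hc]; exact inter_preimage_maxFace c⟩⟩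

lemma pullbackFace_le_iff {G H : facesOf (f '' Q)} : pullbackFace G ≤ pullbackFace H ↔ G ≤ H := by
  constructor
  · intro h y hy
    obtain ⟨x, hx, rfl⟩ := G.2.subset hy
    exact (h ⟨hx, hy⟩ : x ∈ Q ∩ f ⁻¹' H).2
  · exact fun h x hx => ⟨hx.1, h hx.2⟩

lemma polyDim_mono [Module.Finite ℝ M] {F G : Set M} (h : F ⊆ G) : polyDim F ≤ polyDim G := by
  rw [polyDim, polyDim, direction_affineSpan, direction_affineSpan]
  exact Submodule.finrank_mono (vectorSpan_mono ℝ h)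

variable {r k : ℕ} {n : Fin r → ℕ}

/-- Every small face of `Q` is the preimage of a face of its projection, when the skeleton of the
projection is that of the product of simplices. -/
lemma exists_label_comp_eq [Module.Finite ℝ M'] (hQ : ∀ c : M →ₗ[ℝ] ℝ, (maxFace Q c).Nonempty)
    (Φ : facesOf Q ≃o BoxFace fun i => Fin (n i + 1))
    (e : skel k (f '' Q) ≃o skel k (prodSimplex n)) (A : BoxFace fun i => Fin (n i + 1))
    (hA : A.1.card ≤ k + r) :
    ∃ g : M' →ₗ[ℝ] ℝ, (FaceLabelling.ofOrderIso hQ Φ).label (g ∘ₗ f) = A := by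
  let σ : {S : BoxFace fun i => Fin (n i + 1) // S.1.card ≤ k + r} → skel k (prodSimplex n) :=
    fun S => ⟨simplexFace n S.1, isFace_simplexFace S.1, by
      have := polyDim_simplexFace (n := n) S.1
      have := S.2
      omega⟩
  have hσ : ∀ S T, σ S ≤ σ T ↔ S ≤ T := fun S T => simplexFace_subset_iff
  let θ : skel k (f '' Q) → facesOf (f '' Q) := fun G => ⟨G, G.2.1⟩
  have hθ : ∀ G H, θ G ≤ θ H ↔ G ≤ H := fun G H => Iff.rfl
  obtain ⟨S, hS⟩ := exists_eq_of_orderEmbedding (k := k + r)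
    (ψ := fun S => Φ (pullbackFace (θ (e.symm (σ S)))))
    (fun S T => by rw [Φ.le_iff_le, pullbackFace_le_iff, hθ, e.symm.le_iff_le, hσ])
    (fun S T B hBS hBT => by
      rw [← Φ.symm_apply_le] at hBS hBT
      obtain ⟨x, hx⟩ := (Φ.symm B).2.1
      have hF := (e.symm (σ S)).2
      let G : skel k (f '' Q) := ⟨(e.symm (σ S) : Set M') ∩ (e.symm (σ T) : Set M'),
        hF.1.inter (e.symm (σ T)).2.1 ⟨f x, (hBS hx).2, (hBT hx).2⟩,
        (polyDim_mono Set.inter_subset_left).trans hF.2⟩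
      obtain ⟨U, hU⟩ := exists_simplexFace_eq (e G).2.1
      have hUk : U.1.card ≤ k + r := by
        have h1 := polyDim_simplexFace U
        have h2 := (e G).2.2
        rw [← hU] at h2
        omega
      have hUG : σ ⟨U, hUk⟩ = e G := Subtype.ext hU
      refine ⟨⟨U, hUk⟩, ?_, ?_, ?_⟩
      · rw [← hσ, hUG, ← e.le_symm_apply]
        exact Set.inter_subset_left
      · rw [← hσ, hUG, ← e.le_symm_apply]
        exact Set.inter_subset_right
      · rw [← Φ.symm_apply_le, hUG, e.symm_apply_apply]
        exact fun y hy => ⟨(hBS hy).1, (hBS hy).2, (hBT hy).2⟩) A hA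
  obtain ⟨g, hg⟩ := (θ (e.symm (σ S))).2.2
  refine ⟨g, ?_⟩
  rw [← hS]
  refine congrArg Φ (Subtype.ext ?_)
  change maxFace Q (g ∘ₗ f) = Q ∩ f ⁻¹' (θ (e.symm (σ S)) : Set M')
  rw [hg]
  exact (inter_preimage_maxFace g).symm

end Projection

section Dimension

lemma exists_sum_eq_of_le_sum {ι : Type*} [Fintype ι] {b : ι → ℕ} {k : ℕ} (h : k ≤ ∑ i, b i) :
    ∃ m : ι → ℕ, (∀ i, m i ≤ b i) ∧ ∑ i, m i = k := by
  classical
  induction k with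
  | zero => exact ⟨0, fun i => Nat.zero_le _, by simp⟩
  | succ k ih =>
    obtain ⟨m, hm, hsum⟩ := ih (Nat.le_of_succ_le h)
    obtain ⟨i, -, hi⟩ := Finset.exists_lt_of_sum_lt (hsum.trans_lt h)
    refine ⟨Function.update m i (m i + 1), fun j => ?_, ?_⟩
    · rcases eq_or_ne j i with rfl | hj
      · simpa using hi
      · simpa [hj] using hm j
    · rw [Finset.sum_update_of_mem (Finset.mem_univ i), ← hsum,
        ← Finset.add_sum_erase _ m (Finset.mem_univ i), Finset.erase_eq]
      omega

/-- A set of vertices that contains few vertices of each factor and misses `x` extends to a small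
face missing `x`. -/
lemma BoxFace.exists_notMem {r : ℕ} {n : Fin r → ℕ} (hn : ∀ i, 1 ≤ n i) (m : Fin r → ℕ)
    (p : (Σ i, Fin (n i + 1)) → Prop) [DecidablePred p]
    (hp : ∀ i, (Finset.univ.filter fun a => p ⟨i, a⟩).card ≤ m i + 1)
    {x : Σ i, Fin (n i + 1)} (hx : ¬ p x) :
    ∃ A : BoxFace fun i => Fin (n i + 1), (∀ y, p y → y ∈ A.1) ∧ x ∉ A.1 ∧
      A.1.card ≤ ∑ i, m i + r := by
  have : ∀ i, ∃ F : Finset (Fin (n i + 1)), (∀ a, p ⟨i, a⟩ → a ∈ F) ∧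
      (∀ a ∈ F, (⟨i, a⟩ : Σ i, Fin (n i + 1)) ≠ x) ∧ F.Nonempty ∧ F.card ≤ m i + 1 := by
    intro i
    rcases (Finset.univ.filter fun a => p ⟨i, a⟩).eq_empty_or_nonempty with h | h
    · have : Nontrivial (Fin (n i + 1)) := Fin.nontrivial_iff_two_le.2 (by have := hn i; omega)
      obtain ⟨b, hb⟩ : ∃ b : Fin (n i + 1), (⟨i, b⟩ : Σ i, Fin (n i + 1)) ≠ x := by
        by_contra! hall
        obtain ⟨a, b, hab⟩ := exists_pair_ne (Fin (n i + 1))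
        have := (hall a).trans (hall b).symm
        simp [hab] at this
      refine ⟨{b}, fun a ha => ?_, by simpa using hb, by simp, by simp⟩
      have : a ∈ Finset.univ.filter fun a => p ⟨i, a⟩ := by simpa using ha
      simp [h] at this
    · refine ⟨_, by simp, ?_, h, hp i⟩
      rintro a ha rfl
      exact hx (by simpa using ha)
  choose F hF hFx hne hcard using this
  refine ⟨⟨Finset.univ.sigma F, fun i => (hne i).imp fun a ha => by simpa using ha⟩,
    fun y hy => by simpa using hF y.1 y.2 hy, fun h => hFx x.1 x.2 (by simpa using h) rfl, ?_⟩
  rw [Finset.card_sigma]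
  refine (Finset.sum_le_sum fun i _ => hcard i).trans ?_
  simp [Finset.sum_add_distrib]

/-- A nonzero vector at which, in every factor, only few of the given functionals are positive. -/
lemma exists_ne_zero_card_pos_le {r k : ℕ} (hr : 1 ≤ r) {n : Fin r → ℕ} (hn : ∀ i, 1 ≤ n i)
    (hk : k ≤ ∑ i ∈ Finset.univ.filter (fun i : Fin r => 2 ≤ n i), (n i - 2) / 2)
    {W : Type*} [AddCommGroup W] [Module ℝ W] [FiniteDimensional ℝ W]
    (hW : ∑ i, n i ≤ Module.finrank ℝ W + 2 * k +
      (Finset.univ.filter (fun i : Fin r => 2 ≤ n i)).card)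
    (ℓ : (Σ i, Fin (n i + 1)) → W →ₗ[ℝ] ℝ) :
    ∃ w ≠ 0, ∃ m : Fin r → ℕ, ∑ i, m i = k ∧
      ∀ i, (Finset.univ.filter fun a => 0 < ℓ ⟨i, a⟩ w).card ≤ m i + 1 := by
  classical
  obtain ⟨m, hm, hmk⟩ := exists_sum_eq_of_le_sum
    (hk.trans (Finset.sum_le_sum_of_subset (Finset.filter_subset _ _)))
  let t : Fin r → ℕ := fun i => min (2 * m i + 3) (n i + 1)
  let K := Σ i : Fin r, Option {a : Fin (n i + 1) // t i ≤ a}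
  let S : K → Finset (Σ i, Fin (n i + 1))
    | ⟨i, none⟩ => (Finset.univ.filter fun a : Fin (n i + 1) => (a : ℕ) < t i).image (Sigma.mk i)
    | ⟨i, some a⟩ => {⟨i, a⟩}
  have hlt : ∀ i, (Finset.univ.filter fun a : Fin (n i + 1) => (a : ℕ) < t i).card = t i := by
    intro i
    rw [Fin.card_filter_val_lt]
    exact min_eq_right (min_le_right _ _)
  have hcount : ∀ i, Fintype.card (Option {a : Fin (n i + 1) // t i ≤ a}) + 2 * m i +
      (if 2 ≤ n i then 1 else 0) = n i := by
    intro i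
    have h1 := hm i
    have h2 := hn i
    have h3 : Fintype.card {a : Fin (n i + 1) // t i ≤ a} + t i = n i + 1 := by
      rw [Fintype.card_subtype]
      have h4 := Finset.card_filter_add_card_filter_not (s := Finset.univ)
        (fun a : Fin (n i + 1) => t i ≤ a)
      simp only [not_le, hlt, Finset.card_univ, Fintype.card_fin] at h4
      exact h4
    rw [Fintype.card_option]
    simp only [t] at h3 ⊢
    split_ifs <;> omega
  have hcardK : Fintype.card K + 2 * k +
      (Finset.univ.filter (fun i : Fin r => 2 ≤ n i)).card = ∑ i, n i := by
    rw [← Finset.sum_congr rfl fun i _ => hcount i, Fintype.card_sigma, Finset.sum_add_distrib,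
      Finset.sum_add_distrib, ← Finset.mul_sum, hmk, Finset.card_filter]
  have hK : Fintype.card K ≤ Module.finrank ℝ W := by omega
  have hKpos : 0 < Fintype.card K := Fintype.card_pos_iff.2 ⟨⟨⟨0, hr⟩, none⟩⟩
  obtain ⟨w, hw, h⟩ := exists_ne_zero_two_mul_card_positiveAt_le (hKpos.trans_le hK) hK S ℓ
  refine ⟨w, hw, m, hmk, fun i => ?_⟩
  have hsub : (Finset.univ.filter fun a => 0 < ℓ ⟨i, a⟩ w).image (Sigma.mk i) ⊆
      positiveAt ℓ (S ⟨i, none⟩) w := by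
    intro p hp
    obtain ⟨a, ha, rfl⟩ := Finset.mem_image.1 hp
    rw [Finset.mem_filter] at ha
    refine mem_positiveAt.2 ⟨Finset.mem_image.2 ⟨a, ?_, rfl⟩, ha.2⟩
    rw [Finset.mem_filter]
    refine ⟨Finset.mem_univ _, ?_⟩
    by_contra! hat
    have h1 := h ⟨i, some ⟨a, hat⟩⟩
    have h2 : (⟨i, a⟩ : Σ i, Fin (n i + 1)) ∈ positiveAt ℓ (S ⟨i, some ⟨a, hat⟩⟩) w :=
      mem_positiveAt.2 ⟨Finset.mem_singleton_self _, ha.2⟩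
    have h3 := Finset.card_pos.2 ⟨_, h2⟩
    have h4 : (S ⟨i, some ⟨a, hat⟩⟩).card = 1 := Finset.card_singleton _
    omega
  have h1 := Finset.card_le_card hsub
  rw [Finset.card_image_of_injective _ sigma_mk_injective] at h1
  have h2 := h ⟨i, none⟩
  have h3 : (S ⟨i, none⟩).card = t i := by
    exact (Finset.card_image_of_injective _ sigma_mk_injective).trans (hlt i)
  have h4 : t i ≤ 2 * m i + 3 := min_le_left _ _
  omega

/-- A vector parallel to `Q` and killed by the projection vanishes as soon as few facet functionals
are positive on it. -/
lemma eq_zero_of_card_pos_le {r k : ℕ} {n : Fin r → ℕ} (hn : ∀ i, 1 ≤ n i)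
    {M M' : Type*} [AddCommGroup M] [Module ℝ M] [AddCommGroup M'] [Module ℝ M']
    {Q : Set M} {f : M →ₗ[ℝ] M'} {L : FaceLabelling Q fun i => Fin (n i + 1)}
    (hL : ∀ A : BoxFace fun i => Fin (n i + 1), A.1.card ≤ k + r →
      ∃ g : M' →ₗ[ℝ] ℝ, L.label (g ∘ₗ f) = A)
    {ℓ : (Σ i, Fin (n i + 1)) → M →ₗ[ℝ] ℝ} (hℓ : ∀ p q, q ∈ (L.label (ℓ p)).1 ↔ q ≠ p)
    {m : Fin r → ℕ} (hm : ∑ i, m i = k) {w : M} (hw : w ∈ vectorSpan ℝ Q) (hfw : f w = 0)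
    (hpos : ∀ i, (Finset.univ.filter fun a => 0 < ℓ ⟨i, a⟩ w).card ≤ m i + 1) : w = 0 := by
  have key : ∀ v ∈ vectorSpan ℝ Q, f v = 0 →
      (∀ i, (Finset.univ.filter fun a => 0 < ℓ ⟨i, a⟩ v).card ≤ m i + 1) →
      ∀ x, ¬ 0 < ℓ x v → ℓ x v = 0 := by
    intro v hv hfv hposv x hx
    obtain ⟨A, hA, hxA, hcard⟩ := BoxFace.exists_notMem hn m (fun p => 0 < ℓ p v) hposv hx
    obtain ⟨g, rfl⟩ := hL A (hm ▸ hcard)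
    exact FaceLabelling.facet_apply_eq_zero hℓ hv (by simp [hfv])
      (fun p hp => not_lt.1 fun h => hp (hA p h)) hxA
  have hnn : ∀ x, 0 ≤ ℓ x w := fun x => by
    by_contra! h
    exact h.ne (key w hw hfw hpos x h.le.not_gt)
  refine FaceLabelling.eq_zero_of_facets hℓ hw fun x => ?_
  have hneg : ∀ y, ¬ 0 < ℓ y (-w) := fun y => by simpa using hnn y
  have hempty : ∀ i, (Finset.univ.filter fun a => 0 < ℓ ⟨i, a⟩ (-w)).card ≤ m i + 1 := fun i => by
    simp only [hneg, Finset.filter_false, Finset.card_empty, Nat.zero_le]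
  simpa using key (-w) (Submodule.neg_mem _ hw) (by simp [hfw]) hempty x (hneg x)

end Dimension

/-- Theorem `topObstr-small-k`. Let `R = {i : n_i ≥ 2}`. If
`k ≤ Σ_{i ∈ R} ⌊(n_i - 2)/2⌋`, then every `(k,n̄)`-PPSN polytope has dimension at least
`2k + |R| + 1`. -/
theorem statement13 (k r : ℕ) (hr : 1 ≤ r) (n : Fin r → ℕ) (hn : ∀ i, 1 ≤ n i)
    (hk : k ≤ ∑ i ∈ Finset.univ.filter (fun i : Fin r => 2 ≤ n i), (n i - 2) / 2) :
    ∀ (d : ℕ) (P : Set (Fin d → ℝ)), IsPPSN k n P →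
      2 * k + (Finset.univ.filter (fun i : Fin r => 2 ≤ n i)).card + 1 ≤ polyDim P := by
  rintro d P ⟨⟨-, ⟨e⟩⟩, N, Q, f, hQ, rfl, ⟨Φ⟩⟩
  have : ∀ i, Nontrivial (Fin (n i + 1)) := fun i =>
    Fin.nontrivial_iff_two_le.2 (by have := hn i; omega)
  let Ψ := Φ.trans (boxFaceOrderIso n).symm
  have hmax := hQ.maxFace_nonempty (by
    obtain ⟨x, hx⟩ := (Ψ.symm (BoxFace.vertex fun _ => 0)).2.1
    exact ⟨x, (Ψ.symm (BoxFace.vertex fun _ => 0)).2.subset hx⟩)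
  let L := FaceLabelling.ofOrderIso hmax Ψ
  obtain ⟨ℓ, hℓ⟩ := L.exists_facet
  let D := vectorSpan ℝ Q
  let W := LinearMap.ker (f.domRestrict D)
  by_contra! hlt
  have hD : _ ≤ Module.finrank ℝ D + _ := L.card_le_finrank_add
  have hrank : _ + Module.finrank ℝ W = Module.finrank ℝ D :=
    LinearMap.finrank_range_add_finrank_ker (f.domRestrict D)
  have hP : polyDim (f '' Q) = Module.finrank ℝ (LinearMap.range (f.domRestrict D)) := by
    rw [polyDim, direction_affineSpan, LinearMap.range_domRestrict]
    exact congrArg (fun U : Submodule ℝ (Fin d → ℝ) => Module.finrank ℝ U)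
      (f.toAffineMap.map_vectorSpan (s := Q)).symm
  simp only [Fintype.card_sigma, Fintype.card_fin, Finset.sum_add_distrib, Finset.sum_const,
    Finset.card_univ, smul_eq_mul, mul_one] at hD
  obtain ⟨w, hw, m, hm, hpos⟩ := exists_ne_zero_card_pos_le hr hn hk (W := W) (by omega)
    fun p => ℓ p ∘ₗ D.subtype ∘ₗ W.subtype
  refine hw (Subtype.ext (Subtype.ext ?_))
  exact eq_zero_of_card_pos_le hn (fun A hA => exists_label_comp_eq hmax Ψ e A hA) hℓ hm
    w.1.2 w.2 hpos
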